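/- arXiv:1907.00596 — 6 statements merged into one kernel-verified Lean document; each statement's English description precedes it below -/
import Mathlib

section
/- Consider a discrete-time system in the decomposed form x₁^{i₁,+} = f₁^{i₁}(x₁, x₂, u₁) for i₁ = 1,…,n−m₂ and x₂^{i₂,+} = f₂^{i₂}(x₁, x₂, u₁, u₂) for i₂ = 1,…,m₂, with dim(u₂) = dim(x₂) = m₂ and rank(∂_u f) = dim(u) = m. Then the complete system is flat (around an equilibrium) if and only if the subsystem x₁⁺ = f₁(x₁, x₂, u₁), regarded as a discrete-time system with state x₁ and the m inputs (x₂, u₁), is flat. -/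
/-!
Discrete-time systems `x⁺ = f(x,u)` and difference flatness, following
Kolar–Schöberl–Diwold, "Differential-Geometric Decomposition of Flat Nonlinear
Discrete-Time Systems".
-/

open Filter Topology Function

noncomputable section

/-- The forward-shift operator `δ_{xu}` on the space with coordinates
`(x, u, u_[1], u_[2], …)`: a point `(x, (u, u_[1], …))` is sent to
`(f(x,u), (u_[1], u_[2], …))`.  Composing functions with this map realizes the
forward shift of functions. -/
def shift {X U : Type*} (f : X → U → X) : X × (ℕ → U) → X × (ℕ → U) :=
  fun p => (f p.1 (p.2 0), fun k => p.2 (k + 1))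

/-- `φ` is a smooth function `φ(x, u, u_[1], …, u_[q])` of the state and finitely
many forward-shifts of the input. -/
def SmoothFiniteDep {X U Y : Type*} [NormedAddCommGroup X] [NormedSpace ℝ X]
    [NormedAddCommGroup U] [NormedSpace ℝ U] [NormedAddCommGroup Y] [NormedSpace ℝ Y]
    (φ : X × (ℕ → U) → Y) : Prop :=
  ∃ (q : ℕ) (ψ : X × (Fin (q + 1) → U) → Y),
    ContDiff ℝ (⊤ : ℕ∞) ψ ∧ ∀ p, φ p = ψ (p.1, fun k => p.2 k)

/-- `φ` is a flat output of the system `x⁺ = f(x,u)` around `(x₀,u₀)`: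
it is a smooth function of `(x, u, u_[1], …, u_[q])`, and locally around the
point `(x₀, (u₀, u₀, …))` the state `x` and the input `u` can be expressed as a
(smooth) function `E` of `φ` and finitely many of its forward shifts
`φ ∘ δ_{xu}^α`. -/
def IsFlatOutput {X U Y : Type*} [NormedAddCommGroup X] [NormedSpace ℝ X]
    [NormedAddCommGroup U] [NormedSpace ℝ U] [NormedAddCommGroup Y] [NormedSpace ℝ Y]
    (f : X → U → X) (x₀ : X) (u₀ : U) (φ : X × (ℕ → U) → Y) : Prop :=
  SmoothFiniteDep φ ∧
  ∃ (N : ℕ) (E : (Fin N → Y) → X × U), ContDiff ℝ (⊤ : ℕ∞) E ∧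
    ∀ᶠ p in 𝓝 ((x₀, fun _ => u₀) : X × (ℕ → U)),
      E (fun α => φ ((shift f)^[(α : ℕ)] p)) = (p.1, p.2 0)

/-- The system `x⁺ = f(x,u)` is flat around `(x₀,u₀)` if it possesses a flat
output (an `m`-tuple of functions, i.e. a function valued in the input space). -/
def IsFlat {X U : Type*} [NormedAddCommGroup X] [NormedSpace ℝ X]
    [NormedAddCommGroup U] [NormedSpace ℝ U]
    (f : X → U → X) (x₀ : X) (u₀ : U) : Prop :=
  ∃ φ : X × (ℕ → U) → U, IsFlatOutput f x₀ u₀ φ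

section SmoothFiniteDep

variable {X U Y Z : Type*} [NormedAddCommGroup X] [NormedSpace ℝ X]
  [NormedAddCommGroup U] [NormedSpace ℝ U] [NormedAddCommGroup Y] [NormedSpace ℝ Y]
  [NormedAddCommGroup Z] [NormedSpace ℝ Z]

/-- The order `q` in `SmoothFiniteDep` can be chosen arbitrarily large. -/
theorem SmoothFiniteDep.exists_forall_ge {φ : X × (ℕ → U) → Y} (h : SmoothFiniteDep φ) :
    ∃ q₀ : ℕ, ∀ q ≥ q₀, ∃ ψ : X × (Fin (q + 1) → U) → Y,
      ContDiff ℝ (⊤ : ℕ∞) ψ ∧ ∀ p, φ p = ψ (p.1, fun k => p.2 k) := by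
  obtain ⟨q₀, ψ, hψ, h⟩ := h
  refine ⟨q₀, fun q hq => ⟨fun z => ψ (z.1, fun k => z.2 (Fin.castLE (by omega) k)), ?_, ?_⟩⟩
  · fun_prop
  · intro p
    simp [h]

theorem SmoothFiniteDep.contDiff_comp {φ : X × (ℕ → U) → Y} (h : SmoothFiniteDep φ)
    {g : Y → Z} (hg : ContDiff ℝ (⊤ : ℕ∞) g) : SmoothFiniteDep fun p => g (φ p) := by
  obtain ⟨q, ψ, hψ, h⟩ := h
  exact ⟨q, fun z => g (ψ z), hg.comp hψ, fun p => by simp only [h]⟩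

theorem SmoothFiniteDep.prodMk {φ : X × (ℕ → U) → Y} {χ : X × (ℕ → U) → Z}
    (hφ : SmoothFiniteDep φ) (hχ : SmoothFiniteDep χ) :
    SmoothFiniteDep fun p => (φ p, χ p) := by
  obtain ⟨q, hq⟩ := hφ.exists_forall_ge
  obtain ⟨r, hr⟩ := hχ.exists_forall_ge
  obtain ⟨ψ, hψ, hφψ⟩ := hq (max q r) (le_max_left _ _)
  obtain ⟨η, hη, hχη⟩ := hr (max q r) (le_max_right _ _)
  exact ⟨max q r, fun z => (ψ z, η z), hψ.prodMk hη, fun p => by simp only [hφψ, hχη]⟩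

theorem SmoothFiniteDep.pi {ι : Type*} [Fintype ι] {φ : ι → X × (ℕ → U) → Y}
    (h : ∀ i, SmoothFiniteDep (φ i)) : SmoothFiniteDep fun p i => φ i p := by
  choose q hq using fun i => (h i).exists_forall_ge
  choose ψ hψ hφψ using fun i =>
    hq i (Finset.univ.sup q) (Finset.le_sup (f := q) (Finset.mem_univ i))
  exact ⟨_, fun z i => ψ i z, contDiff_pi.2 hψ, fun p => funext fun i => hφψ i p⟩

theorem smoothFiniteDep_fst : SmoothFiniteDep fun p : X × (ℕ → U) => p.1 :=
  ⟨0, fun z => z.1, contDiff_fst, fun _ => rfl⟩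

theorem smoothFiniteDep_input (k : ℕ) : SmoothFiniteDep fun p : X × (ℕ → U) => p.2 k :=
  ⟨k, fun z => z.2 (Fin.last k), by fun_prop, fun p => by simp⟩

theorem SmoothFiniteDep.continuous {φ : X × (ℕ → U) → Y} (h : SmoothFiniteDep φ) :
    Continuous φ := by
  obtain ⟨q, ψ, hψ, h⟩ := h
  rw [funext h]
  exact hψ.continuous.comp (by fun_prop)

/-- Smooth functions of finitely many coordinates pull back along maps whose components are
smooth functions of finitely many coordinates. -/
theorem SmoothFiniteDep.comp {X' U' : Type*} [NormedAddCommGroup X'] [NormedSpace ℝ X']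
    [NormedAddCommGroup U'] [NormedSpace ℝ U'] {φ : X' × (ℕ → U') → Y}
    (hφ : SmoothFiniteDep φ) {T : X × (ℕ → U) → X' × (ℕ → U')}
    (hT₁ : SmoothFiniteDep fun p => (T p).1) (hT₂ : ∀ k, SmoothFiniteDep fun p => (T p).2 k) :
    SmoothFiniteDep fun p => φ (T p) := by
  obtain ⟨q, ψ, hψ, h⟩ := hφ
  simp only [h]
  exact (hT₁.prodMk (SmoothFiniteDep.pi fun k : Fin (q + 1) => hT₂ k)).contDiff_comp hψ

theorem continuous_of_smoothFiniteDep {X' U' : Type*} [NormedAddCommGroup X'] [NormedSpace ℝ X']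
    [NormedAddCommGroup U'] [NormedSpace ℝ U'] {T : X × (ℕ → U) → X' × (ℕ → U')}
    (hT₁ : SmoothFiniteDep fun p => (T p).1) (hT₂ : ∀ k, SmoothFiniteDep fun p => (T p).2 k) :
    Continuous T :=
  hT₁.continuous.prodMk (continuous_pi fun k => (hT₂ k).continuous)

theorem SmoothFiniteDep.comp_shift {f : X → U → X}
    (hf : ContDiff ℝ (⊤ : ℕ∞) fun z : X × U => f z.1 z.2) {φ : X × (ℕ → U) → Y}
    (hφ : SmoothFiniteDep φ) : SmoothFiniteDep fun p => φ (shift f p) :=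
  hφ.comp ((smoothFiniteDep_fst.prodMk (smoothFiniteDep_input 0)).contDiff_comp hf)
    fun k => smoothFiniteDep_input (k + 1)

theorem SmoothFiniteDep.comp_iterate_shift {f : X → U → X}
    (hf : ContDiff ℝ (⊤ : ℕ∞) fun z : X × U => f z.1 z.2) {φ : X × (ℕ → U) → Y}
    (hφ : SmoothFiniteDep φ) (k : ℕ) : SmoothFiniteDep fun p => φ ((shift f)^[k] p) := by
  induction k with
  | zero => exact hφ
  | succ k ih => exact ih.comp_shift hf

theorem continuous_shift {f : X → U → X}
    (hf : ContDiff ℝ (⊤ : ℕ∞) fun z : X × U => f z.1 z.2) : Continuous (shift f) :=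
  continuous_of_smoothFiniteDep (smoothFiniteDep_fst.comp_shift hf)
    fun k => (smoothFiniteDep_input k).comp_shift hf

end SmoothFiniteDep

theorem shift_equilibrium {X U : Type*} {f : X → U → X} {x₀ : X} {u₀ : U} (h : f x₀ u₀ = x₀) :
    shift f (x₀, fun _ => u₀) = (x₀, fun _ => u₀) := by
  simp [shift, h]

/-- A property that holds near a fixed point of a continuous map holds near that point for any
given iterate. -/
theorem Filter.Eventually.iterate_of_isFixedPt {α : Type*} [TopologicalSpace α] {s : α → α} {a : α}
    (hs : Continuous s) (ha : s a = a) {P : α → Prop} (h : ∀ᶠ p in 𝓝 a, P p) (k : ℕ) :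
    ∀ᶠ p in 𝓝 a, P (s^[k] p) := by
  have ht : Tendsto s^[k] (𝓝 a) (𝓝 a) := by
    have := (hs.iterate k).tendsto a
    rwa [Function.iterate_fixed ha] at this
  exact ht.eventually h

/-- A map which semiconjugates `s` to `t` near a fixed point of `s` semiconjugates the iterates
near that point. -/
theorem eventually_iterate_semiconj {α β : Type*} [TopologicalSpace α] {s : α → α} {t : β → β}
    {T : α → β} {a : α} (hs : Continuous s) (ha : s a = a)
    (h : ∀ᶠ p in 𝓝 a, T (s p) = t (T p)) (k : ℕ) :
    ∀ᶠ p in 𝓝 a, T (s^[k] p) = t^[k] (T p) := by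
  induction k with
  | zero => exact Eventually.of_forall fun _ => rfl
  | succ k ih =>
    filter_upwards [ih, h.iterate_of_isFixedPt hs ha k] with p hp hp'
    rw [iterate_succ_apply', iterate_succ_apply', hp', hp]

/-- A function which is smooth on an open set agrees near any point of it with a globally smooth
function. -/
theorem ContDiffOn.exists_contDiff_eventuallyEq {E V : Type*} [NormedAddCommGroup E]
    [NormedSpace ℝ E] [FiniteDimensional ℝ E] [NormedAddCommGroup V] [NormedSpace ℝ V]
    {h : E → V} {s : Set E} (hs : IsOpen s) (hh : ContDiffOn ℝ (⊤ : ℕ∞) h s) {x : E}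
    (hx : x ∈ s) : ∃ H : E → V, ContDiff ℝ (⊤ : ℕ∞) H ∧ H =ᶠ[𝓝 x] h := by
  obtain ⟨ε, hε, hεs⟩ := Metric.nhds_basis_closedBall.mem_iff.1 (hs.mem_nhds hx)
  let χ : ContDiffBump x := ⟨ε / 2, ε, half_pos hε, half_lt_self hε⟩
  refine ⟨fun y => χ y • h y, contDiff_iff_contDiffAt.2 fun y => ?_, ?_⟩
  · by_cases hy : y ∈ s
    · exact χ.contDiffAt.smul (hh.contDiffAt (hs.mem_nhds hy))
    · have hχ : χ =ᶠ[𝓝 y] 0 := notMem_tsupport_iff_eventuallyEq.1 fun hy' =>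
        hy (hεs (by simpa [χ.tsupport_eq] using hy'))
      refine (contDiffAt_const (c := 0)).congr_of_eventuallyEq ?_
      filter_upwards [hχ] with z hz
      simp [hz]
  · filter_upwards [χ.eventuallyEq_one] with y hy
    simp [hy]

/-- Global-function form of the implicit function theorem: the equation `g (a, b) = c` can be
solved near `(a₀, b₀)` for `b` by a smooth function of `(a, c)`. -/
theorem exists_contDiff_partial_inverse {A B : Type*} [NormedAddCommGroup A] [NormedSpace ℝ A]
    [FiniteDimensional ℝ A] [NormedAddCommGroup B] [NormedSpace ℝ B] [FiniteDimensional ℝ B]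
    {g : A × B → B} (hg : ContDiff ℝ (⊤ : ℕ∞) g)
    (hinj : ∀ a b, Injective (fderiv ℝ (fun b' => g (a, b')) b)) (a₀ : A) (b₀ : B) :
    ∃ H : A × B → B, ContDiff ℝ (⊤ : ℕ∞) H ∧
      (∀ᶠ z in 𝓝 (a₀, b₀), H (z.1, g z) = z.2) ∧
      ∀ᶠ w in 𝓝 (a₀, g (a₀, b₀)), g (w.1, H w) = w.2 := by
  have : CompleteSpace (A × B) := FiniteDimensional.complete ℝ _
  let Ψ : A × B → A × B := fun z => (z.1, g z)
  have hΨ : ContDiff ℝ (⊤ : ℕ∞) Ψ := contDiff_fst.prodMk hg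
  have hgd : ∀ z, HasFDerivAt g (fderiv ℝ g z) z := fun z =>
    (hg.differentiable (by simp) z).hasFDerivAt
  have hderiv : ∀ z, ∃ e : (A × B) ≃L[ℝ] (A × B), HasFDerivAt Ψ (e : (A × B) →L[ℝ] (A × B)) z := by
    intro z
    let L : (A × B) →L[ℝ] (A × B) := (ContinuousLinearMap.fst ℝ A B).prod (fderiv ℝ g z)
    have hL : HasFDerivAt Ψ L z := hasFDerivAt_fst.prodMk (hgd z)
    have hLinj : Injective L := by
      rw [injective_iff_map_eq_zero]
      rintro ⟨v, w⟩ hvw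
      obtain ⟨rfl, hw⟩ : v = 0 ∧ fderiv ℝ g z (v, w) = 0 := by simpa [L] using hvw
      have hpart : fderiv ℝ (fun b' => g (z.1, b')) z.2
          = (fderiv ℝ g z).comp (ContinuousLinearMap.inr ℝ A B) :=
        ((hgd z).comp z.2 (hasFDerivAt_prodMk_right z.1 z.2)).fderiv
      have hw0 : w = 0 :=
        (injective_iff_map_eq_zero _).1 (hinj z.1 z.2) w (by simpa [hpart] using hw)
      simp [hw0]
    exact ⟨(LinearEquiv.ofInjectiveEndo (L : (A × B) →ₗ[ℝ] (A × B))
      hLinj).toContinuousLinearEquiv, hL⟩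
  obtain ⟨e₀, he₀⟩ := hderiv (a₀, b₀)
  let e := (hΨ.contDiffAt (x := (a₀, b₀))).toOpenPartialHomeomorph Ψ he₀ (by simp)
  have he : ∀ z, e z = Ψ z := fun _ => rfl
  have hmem : (a₀, b₀) ∈ e.source :=
    (hΨ.contDiffAt (x := (a₀, b₀))).mem_toOpenPartialHomeomorph_source he₀ (by simp)
  have hsymm : ContDiffOn ℝ (⊤ : ℕ∞) e.symm e.target := by
    intro w hw
    obtain ⟨e', he'⟩ := hderiv (e.symm w)
    exact (e.contDiffAt_symm hw he' hΨ.contDiffAt).contDiffWithinAt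
  obtain ⟨H, hH, hHe⟩ := ContDiffOn.exists_contDiff_eventuallyEq e.open_target hsymm.snd
    (e.map_source hmem)
  have hΨ₀ : e (a₀, b₀) = (a₀, g (a₀, b₀)) := rfl
  refine ⟨H, hH, ?_, ?_⟩
  · have ht : Tendsto Ψ (𝓝 (a₀, b₀)) (𝓝 (e (a₀, b₀))) := hΨ.continuous.tendsto _
    filter_upwards [ht.eventually hHe, e.open_source.mem_nhds hmem] with z hz hzs
    change H (Ψ z) = z.2
    rw [hz, ← he, e.left_inv hzs]
  · rw [← hΨ₀]
    filter_upwards [hHe, e.open_target.mem_nhds (e.map_source hmem)] with w hw hwt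
    have hr : Ψ (e.symm w) = w := e.right_inv hwt
    obtain ⟨h₁, h₂⟩ : (e.symm w).1 = w.1 ∧ g (e.symm w) = w.2 := Prod.ext_iff.1 hr
    rw [hw, ← h₁]
    exact h₂

/-- A system in the decomposed form
`x₁⁺ = f₁(x₁,x₂,u₁)`, `x₂⁺ = f₂(x₁,x₂,u₁,u₂)` with `dim u₂ = dim x₂ = m₂` and
`rank ∂_u f = dim u = m` is flat (around an equilibrium) if and only if the
subsystem `x₁⁺ = f₁(x₁,x₂,u₁)` with the `m` inputs `(x₂,u₁)` is flat. -/
theorem decomposed_system_flat_iff_subsystem_flat {n₁ m₁ m₂ : ℕ}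
    (f₁ : (Fin n₁ → ℝ) → (Fin m₂ → ℝ) → (Fin m₁ → ℝ) → (Fin n₁ → ℝ))
    (f₂ : (Fin n₁ → ℝ) → (Fin m₂ → ℝ) → (Fin m₁ → ℝ) → (Fin m₂ → ℝ) → (Fin m₂ → ℝ))
    (hf₁ : ContDiff ℝ (⊤ : ℕ∞)
      fun z : ((Fin n₁ → ℝ) × (Fin m₂ → ℝ)) × (Fin m₁ → ℝ) => f₁ z.1.1 z.1.2 z.2)
    (hf₂ : ContDiff ℝ (⊤ : ℕ∞)
      fun z : ((Fin n₁ → ℝ) × (Fin m₂ → ℝ)) × ((Fin m₁ → ℝ) × (Fin m₂ → ℝ)) =>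
        f₂ z.1.1 z.1.2 z.2.1 z.2.2)
    -- the complete system, with state `(x₁,x₂)` and input `(u₁,u₂)`
    (F : ((Fin n₁ → ℝ) × (Fin m₂ → ℝ)) → ((Fin m₁ → ℝ) × (Fin m₂ → ℝ)) →
      ((Fin n₁ → ℝ) × (Fin m₂ → ℝ)))
    (hF : ∀ x u, F x u = (f₁ x.1 x.2 u.1, f₂ x.1 x.2 u.1 u.2))
    -- the subsystem, with state `x₁` and the `m = m₁ + m₂` inputs `(x₂,u₁)`
    (G : (Fin n₁ → ℝ) → ((Fin m₂ → ℝ) × (Fin m₁ → ℝ)) → (Fin n₁ → ℝ))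
    (hG : ∀ x₁ v, G x₁ v = f₁ x₁ v.1 v.2)
    -- `rank ∂_u f = dim u = m`
    (hrank : ∀ x u, Function.Injective (fderiv ℝ (F x) u))
    -- an equilibrium of the complete system
    (x₁0 : Fin n₁ → ℝ) (x₂0 : Fin m₂ → ℝ) (u₁0 : Fin m₁ → ℝ) (u₂0 : Fin m₂ → ℝ)
    (heq : (x₁0, x₂0) = F (x₁0, x₂0) (u₁0, u₂0)) :
    IsFlat F (x₁0, x₂0) (u₁0, u₂0) ↔ IsFlat G x₁0 (x₂0, u₁0) := by
  obtain ⟨heq₁, heq₂⟩ : x₁0 = f₁ x₁0 x₂0 u₁0 ∧ x₂0 = f₂ x₁0 x₂0 u₁0 u₂0 := by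
    simpa [hF] using heq
  have hFs : ContDiff ℝ (⊤ : ℕ∞)
      fun z : ((Fin n₁ → ℝ) × (Fin m₂ → ℝ)) × ((Fin m₁ → ℝ) × (Fin m₂ → ℝ)) => F z.1 z.2 := by
    simp only [hF]
    exact (hf₁.comp (contDiff_fst.prodMk contDiff_snd.fst)).prodMk hf₂
  have hGs : ContDiff ℝ (⊤ : ℕ∞)
      fun z : (Fin n₁ → ℝ) × ((Fin m₂ → ℝ) × (Fin m₁ → ℝ)) => G z.1 z.2 := by
    simp only [hG]
    exact hf₁.comp ((contDiff_fst.prodMk contDiff_snd.fst).prodMk contDiff_snd.snd)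
  have hFfix : shift F ((x₁0, x₂0), fun _ => (u₁0, u₂0)) = ((x₁0, x₂0), fun _ => (u₁0, u₂0)) :=
    shift_equilibrium heq.symm
  have hGfix : shift G (x₁0, fun _ => (x₂0, u₁0)) = (x₁0, fun _ => (x₂0, u₁0)) :=
    shift_equilibrium (by rw [hG, ← heq₁])
  let g : (((Fin n₁ → ℝ) × (Fin m₂ → ℝ)) × (Fin m₁ → ℝ)) × (Fin m₂ → ℝ) → (Fin m₂ → ℝ) :=
    fun z => f₂ z.1.1.1 z.1.1.2 z.1.2 z.2
  have hg : ContDiff ℝ (⊤ : ℕ∞) g :=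
    hf₂.comp (contDiff_fst.fst.prodMk (contDiff_fst.snd.prodMk contDiff_snd))
  have hinj : ∀ a b, Injective (fderiv ℝ (fun b' => g (a, b')) b) := by
    intro a b
    rw [injective_iff_map_eq_zero]
    intro w hw
    have hFd : HasFDerivAt (F a.1) (fderiv ℝ (F a.1) (a.2, b)) (a.2, b) :=
      ((hFs.comp (contDiff_const.prodMk contDiff_id)).differentiable
        (by simp) (a.2, b)).hasFDerivAt
    have hgd : HasFDerivAt (fun b' => g (a, b')) (fderiv ℝ (fun b' => g (a, b')) b) b :=
      ((hg.comp (contDiff_const.prodMk contDiff_id)).differentiable (by simp) b).hasFDerivAt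
    have hcomp := hFd.comp b (hasFDerivAt_prodMk_right a.2 b)
    have hcomp' := (hasFDerivAt_const (f₁ a.1.1 a.1.2 a.2) b).prodMk hgd
    have hfun : F a.1 ∘ Prod.mk a.2 = fun b' => (f₁ a.1.1 a.1.2 a.2, g (a, b')) :=
      funext fun b' => hF _ _
    rw [hfun] at hcomp
    have h0 := DFunLike.congr_fun (hcomp.unique hcomp') w
    have h1 : ((0 : Fin m₁ → ℝ), w) = 0 :=
      (injective_iff_map_eq_zero _).1 (hrank a.1 (a.2, b)) _ (by simpa [hw, Prod.mk_zero_zero] using h0)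
    exact congrArg Prod.snd h1
  obtain ⟨H, hH, hHleft, hHright⟩ :=
    exists_contDiff_partial_inverse hg hinj ((x₁0, x₂0), u₁0) u₂0
  have hg₀ : g (((x₁0, x₂0), u₁0), u₂0) = x₂0 := heq₂.symm
  have hH₀ : H (((x₁0, x₂0), u₁0), x₂0) = u₂0 := by
    have := hHleft.self_of_nhds
    rwa [hg₀] at this
  rw [hg₀] at hHright
  constructor
  · rintro ⟨φ, hφ, N, E, hE, hEφ⟩
    -- on trajectories of the subsystem the missing input `u₂` is recovered through `H`
    let w : (Fin n₁ → ℝ) × (ℕ → (Fin m₂ → ℝ) × (Fin m₁ → ℝ)) →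
        (((Fin n₁ → ℝ) × (Fin m₂ → ℝ)) × (Fin m₁ → ℝ)) × (Fin m₂ → ℝ) :=
      fun p => (((p.1, (p.2 0).1), (p.2 0).2), (p.2 1).1)
    have hw : SmoothFiniteDep w :=
      ((smoothFiniteDep_fst.prodMk ((smoothFiniteDep_input 0).contDiff_comp contDiff_fst)).prodMk
        ((smoothFiniteDep_input 0).contDiff_comp contDiff_snd)).prodMk
        ((smoothFiniteDep_input 1).contDiff_comp contDiff_fst)
    let T : (Fin n₁ → ℝ) × (ℕ → (Fin m₂ → ℝ) × (Fin m₁ → ℝ)) →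
        ((Fin n₁ → ℝ) × (Fin m₂ → ℝ)) × (ℕ → (Fin m₁ → ℝ) × (Fin m₂ → ℝ)) :=
      fun p => ((p.1, (p.2 0).1), fun k => ((p.2 k).2, H (w ((shift G)^[k] p))))
    have hT₁ : SmoothFiniteDep fun p => (T p).1 :=
      smoothFiniteDep_fst.prodMk ((smoothFiniteDep_input 0).contDiff_comp contDiff_fst)
    have hT₂ : ∀ k, SmoothFiniteDep fun p => (T p).2 k := fun k =>
      ((smoothFiniteDep_input k).contDiff_comp contDiff_snd).prodMk
        ((hw.contDiff_comp hH).comp_iterate_shift hGs k)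
    have hTfix : T (x₁0, fun _ => (x₂0, u₁0)) = ((x₁0, x₂0), fun _ => (u₁0, u₂0)) := by
      simp only [T, w, iterate_fixed hGfix, hH₀]
    have hsemi : ∀ᶠ p in 𝓝 (x₁0, fun _ => (x₂0, u₁0)), T (shift G p) = shift F (T p) := by
      filter_upwards [(hw.continuous.tendsto (x₁0, fun _ => (x₂0, u₁0))).eventually hHright]
        with p hp
      refine Prod.ext (Eq.trans ?_ (hF _ _).symm) rfl
      exact Prod.ext (hG _ _) hp.symm
    have hTt := (continuous_of_smoothFiniteDep hT₁ hT₂).tendsto (x₁0, fun _ => (x₂0, u₁0))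
    rw [hTfix] at hTt
    refine ⟨fun p => (φ (T p)).swap, (hφ.comp hT₁ hT₂).contDiff_comp
      (contDiff_snd.prodMk contDiff_fst), N,
      fun y => ((E fun α => (y α).swap).1.1,
        ((E fun α => (y α).swap).1.2, (E fun α => (y α).swap).2.1)), ?_, ?_⟩
    · have hE' : ContDiff ℝ (⊤ : ℕ∞)
          fun y : Fin N → (Fin m₂ → ℝ) × (Fin m₁ → ℝ) => E fun α => (y α).swap :=
        hE.comp (contDiff_pi.2 fun α =>
          (contDiff_apply ℝ _ α).snd.prodMk (contDiff_apply ℝ _ α).fst)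
      exact hE'.fst.fst.prodMk (hE'.fst.snd.prodMk hE'.snd.fst)
    · filter_upwards [hTt.eventually hEφ, eventually_all.2 fun α : Fin N =>
        eventually_iterate_semiconj (continuous_shift hGs) hGfix hsemi α] with p hp hp'
      simp only [Prod.swap_swap, hp', hp]
      rfl
  · rintro ⟨φ, hφ, N, E, hE, hEφ⟩
    -- the trajectory of the subsystem underlying a trajectory of the complete system
    let T : ((Fin n₁ → ℝ) × (Fin m₂ → ℝ)) × (ℕ → (Fin m₁ → ℝ) × (Fin m₂ → ℝ)) →
        (Fin n₁ → ℝ) × (ℕ → (Fin m₂ → ℝ) × (Fin m₁ → ℝ)) :=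
      fun p => (p.1.1, fun k => (((shift F)^[k] p).1.2, (p.2 k).1))
    have hT₁ : SmoothFiniteDep fun p => (T p).1 := smoothFiniteDep_fst.contDiff_comp contDiff_fst
    have hT₂ : ∀ k, SmoothFiniteDep fun p => (T p).2 k := fun k =>
      ((smoothFiniteDep_fst.contDiff_comp contDiff_snd).comp_iterate_shift hFs k).prodMk
        ((smoothFiniteDep_input k).contDiff_comp contDiff_fst)
    have hTfix : T ((x₁0, x₂0), fun _ => (u₁0, u₂0)) = (x₁0, fun _ => (x₂0, u₁0)) := by
      simp only [T, iterate_fixed hFfix]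
    have hsemi : Semiconj T (shift F) (shift G) := by
      intro p
      refine Prod.ext (Eq.trans ?_ (hG _ _).symm) rfl
      exact congrArg Prod.fst (hF _ _)
    have hTt := (continuous_of_smoothFiniteDep hT₁ hT₂).tendsto
      ((x₁0, x₂0), fun _ => (u₁0, u₂0))
    rw [hTfix] at hTt
    let E₀ : (Fin (N + 1) → (Fin m₁ → ℝ) × (Fin m₂ → ℝ)) →
        (Fin n₁ → ℝ) × ((Fin m₂ → ℝ) × (Fin m₁ → ℝ)) :=
      fun y => E fun α => (y α.castSucc).swap
    let E₁ : (Fin (N + 1) → (Fin m₁ → ℝ) × (Fin m₂ → ℝ)) →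
        (Fin n₁ → ℝ) × ((Fin m₂ → ℝ) × (Fin m₁ → ℝ)) :=
      fun y => E fun α => (y α.succ).swap
    have hE₀ : ContDiff ℝ (⊤ : ℕ∞) E₀ := hE.comp (contDiff_pi.2 fun α =>
      (contDiff_apply ℝ _ α.castSucc).snd.prodMk (contDiff_apply ℝ _ α.castSucc).fst)
    have hE₁ : ContDiff ℝ (⊤ : ℕ∞) E₁ := hE.comp (contDiff_pi.2 fun α =>
      (contDiff_apply ℝ _ α.succ).snd.prodMk (contDiff_apply ℝ _ α.succ).fst)
    refine ⟨fun p => (φ (T p)).swap, (hφ.comp hT₁ hT₂).contDiff_comp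
      (contDiff_snd.prodMk contDiff_fst), N + 1,
      fun y => (((E₀ y).1, (E₀ y).2.1), ((E₀ y).2.2,
        H ((((E₀ y).1, (E₀ y).2.1), (E₀ y).2.2), (E₁ y).2.1))), ?_, ?_⟩
    · have hs := (hE₀.fst.prodMk hE₀.snd.fst).prodMk hE₀.snd.snd
      exact hs.fst.prodMk (hs.snd.prodMk (hH.comp (hs.prodMk hE₁.snd.fst)))
    · have hzt : Tendsto (fun p : ((Fin n₁ → ℝ) × (Fin m₂ → ℝ)) ×
          (ℕ → (Fin m₁ → ℝ) × (Fin m₂ → ℝ)) => ((p.1, (p.2 0).1), (p.2 0).2))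
          (𝓝 ((x₁0, x₂0), fun _ => (u₁0, u₂0))) (𝓝 (((x₁0, x₂0), u₁0), u₂0)) :=
        Continuous.tendsto (by fun_prop) _
      have hEF := hTt.eventually hEφ
      filter_upwards [hEF, hEF.iterate_of_isFixedPt (continuous_shift hFs) hFfix 1,
        hzt.eventually hHleft] with p hp hp' hH'
      have h₀ : E₀ (fun α => (φ (T ((shift F)^[(α : ℕ)] p))).swap)
          = (p.1.1, (p.1.2, (p.2 0).1)) := by
        simp only [E₀, Prod.swap_swap, Fin.val_castSucc, (hsemi.iterate_right _).eq, hp]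
        rfl
      have h₁ : (E₁ fun α => (φ (T ((shift F)^[(α : ℕ)] p))).swap).2.1
          = g ((p.1, (p.2 0).1), (p.2 0).2) := by
        simp only [E₁, Prod.swap_swap, Fin.val_succ, iterate_succ_apply,
          (hsemi.iterate_right _).eq]
        simp only [iterate_one] at hp'
        rw [← hsemi.eq, hp']
        exact congrArg Prod.snd (hF _ _)
      rw [h₀, h₁]
      exact Prod.ext rfl (Prod.ext rfl hH')
end
end

section
/- If y = φ(x, u, u_[1], …, u_[q]) is a flat output of a flat discrete-time system x⁺ = f(x,u), then for every β ≥ 0 the m(β+1) functions φ, δ_{xu}(φ), δ_{xu}²(φ), …, δ_{xu}^β(φ) are functionally independent (their combined Jacobian with respect to (x, u, u_[1], u_[2], …) has full row rank m(β+1)). -/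
/-!
Discrete-time systems `x⁺ = f(x,u)` and difference flatness, following
Kolar–Schöberl–Diwold, "Differential-Geometric Decomposition of Flat Nonlinear
Discrete-Time Systems".
-/

open Filter Topology Function

noncomputable section

section LinearAlgebra

theorem snd_iterate_of_snd_eq_tail {X U : Type*} (S : X × (ℕ → U) → X × (ℕ → U))
    (hS : ∀ p k, (S p).2 k = p.2 (k + 1)) (j : ℕ) (p : X × (ℕ → U)) (k : ℕ) :
    (S^[j] p).2 k = p.2 (k + j) := by
  induction j generalizing k with
  | zero => rfl
  | succ j ih => rw [iterate_succ_apply', hS, ih, add_assoc, add_comm 1 j]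

variable {𝕜 X U : Type*} [Field 𝕜] [AddCommGroup X] [Module 𝕜 X] [AddCommGroup U] [Module 𝕜 U]

/-- If the current input can be reconstructed from finitely many shifts of a linear output with as
many components as the input, then all shifts of that output are independent. -/
theorem surjective_pi_shifts_of_input_reconstructible [FiniteDimensional 𝕜 U]
    (S : X × (ℕ → U) →ₗ[𝕜] X × (ℕ → U)) (hS : ∀ p k, (S p).2 k = p.2 (k + 1))
    (L : X × (ℕ → U) →ₗ[𝕜] U) (N : ℕ)
    (hN : ∀ p, (∀ α < N, L (S^[α] p) = 0) → p.2 0 = 0) (b : ℕ) :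
    Surjective (LinearMap.pi fun α : Fin b => L ∘ₗ (S ^ (α : ℕ))) := by
  set T : X × (ℕ → U) →ₗ[𝕜] (Fin b → U) := LinearMap.pi fun α : Fin b => L ∘ₗ (S ^ (α : ℕ)) with hT
  rw [← LinearMap.range_eq_top]
  by_contra hne
  have hlt := Submodule.finrank_lt hne
  have hb : 0 < b := by
    by_contra h
    obtain rfl : b = 0 := by lia
    simp [Module.finrank_pi_fintype] at hlt
  set m := Module.finrank 𝕜 U with hm
  rw [Module.finrank_pi_fintype] at hlt
  simp only [Finset.sum_const, Finset.card_univ, Fintype.card_fin, smul_eq_mul, ← hm] at hlt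
  have key : ∀ r K : ℕ, K + N ≤ r * b →
      K * m ≤ r * Module.finrank 𝕜 (LinearMap.range T) := by
    intro r K hK
    let s : (Fin K → U) →ₗ[𝕜] X × (ℕ → U) :=
      LinearMap.prod 0 (LinearMap.pi fun k =>
        if h : k < K then LinearMap.proj (⟨k, h⟩ : Fin K) else 0)
    let Q : (Fin K → U) →ₗ[𝕜] (Fin r → LinearMap.range T) :=
      LinearMap.pi fun i => T.rangeRestrict ∘ₗ (S ^ (b * (i : ℕ))) ∘ₗ s
    have hQ : Injective Q := by
      rw [← LinearMap.ker_eq_bot, LinearMap.ker_eq_bot']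
      intro a ha
      have hzero : ∀ j < r * b, L (S^[j] (s a)) = 0 := by
        intro j hj
        have h1 := congrArg Subtype.val (congrFun ha ⟨j / b, Nat.div_lt_of_lt_mul (by lia)⟩)
        have h2 := congrFun h1 ⟨j % b, Nat.mod_lt _ hb⟩
        simp only [Q, hT, LinearMap.pi_apply, LinearMap.comp_apply, LinearMap.codRestrict_apply,
          LinearMap.rangeRestrict, Module.End.coe_pow, ← iterate_add_apply, Nat.mod_add_div] at h2
        simpa using h2
      funext k
      have h3 : (S^[(k : ℕ)] (s a)).2 0 = 0 := by
        refine hN _ fun α hα => ?_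
        rw [← iterate_add_apply]
        exact hzero _ (by have := k.2; lia)
      rw [snd_iterate_of_snd_eq_tail S hS] at h3
      simpa [s] using h3
    have := LinearMap.finrank_le_finrank_of_injective hQ
    simpa [Module.finrank_pi_fintype, ← hm] using this
  set d := Module.finrank 𝕜 (LinearMap.range T)
  have hNr : N ≤ (m * N + N + 1) * b := by nlinarith [Nat.zero_le (m * N)]
  obtain ⟨K, hK⟩ := Nat.exists_eq_add_of_le' hNr
  have h1 := key _ K hK.ge
  have h2 : (m * N + N + 1) * (d + 1) ≤ (m * N + N + 1) * (b * m) := Nat.mul_le_mul_left _ hlt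
  have h3 : (m * N + N + 1) * (b * m) = K * m + N * m := by rw [← mul_assoc, hK, add_mul]
  nlinarith

end LinearAlgebra

section Calculus

variable {W X U Y : Type*} [NormedAddCommGroup W] [NormedSpace ℝ W]
  [NormedAddCommGroup X] [NormedSpace ℝ X] [NormedAddCommGroup U] [NormedSpace ℝ U]
  [NormedAddCommGroup Y] [NormedSpace ℝ Y]

theorem ContinuousLinearMap.eventually_surjective [CompleteSpace Y] [FiniteDimensional ℝ Y]
    {A : W →L[ℝ] Y} (hA : Surjective A) : ∀ᶠ B in 𝓝 A, Surjective (B : W →L[ℝ] Y) := by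
  obtain ⟨C, hC⟩ := A.exists_rightInverse_of_surjective (LinearMap.range_eq_top.2 hA)
  have hcont : Tendsto (fun B : W →L[ℝ] Y => B ∘L C) (𝓝 A) (𝓝 (A ∘L C)) :=
    (continuous_id.clm_comp continuous_const).tendsto A
  have hunit : ∀ᶠ D in 𝓝 (A ∘L C), IsUnit D :=
    Units.isOpen.mem_nhds (by rw [hC]; exact isUnit_one)
  filter_upwards [hcont.eventually hunit] with B hB
  obtain ⟨e, he⟩ := hB
  intro y
  refine ⟨C ((↑e⁻¹ : Y →L[ℝ] Y) y), ?_⟩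
  have h := congrArg (fun D : Y →L[ℝ] Y => D y) e.mul_inv
  rw [he] at h
  exact h

/-- A map into `X × (ℕ → U)` has derivative `G` at `w` in every coordinate. -/
def HasCoordFDerivAt (g : W → X × (ℕ → U)) (G : W →L[ℝ] X × (ℕ → U)) (w : W) : Prop :=
  HasFDerivAt (fun z => (g z).1) (ContinuousLinearMap.fst ℝ X (ℕ → U) ∘L G) w ∧
  ∀ k, HasFDerivAt (fun z => (g z).2 k)
    (ContinuousLinearMap.proj k ∘L ContinuousLinearMap.snd ℝ X (ℕ → U) ∘L G) w

/-- The linearization of the shift map, where `F` is the derivative of the system map. -/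
def linearShift (F : X × U →L[ℝ] X) : X × (ℕ → U) →L[ℝ] X × (ℕ → U) :=
  (F ∘L (ContinuousLinearMap.fst ℝ X (ℕ → U)).prod
    (ContinuousLinearMap.proj 0 ∘L ContinuousLinearMap.snd ℝ X (ℕ → U))).prod
  (ContinuousLinearMap.pi fun k =>
    ContinuousLinearMap.proj (k + 1) ∘L ContinuousLinearMap.snd ℝ X (ℕ → U))

/-- Restriction to the state and the first `M` inputs. -/
def restrictInputs (M : ℕ) : X × (ℕ → U) →L[ℝ] X × (Fin M → U) :=
  (ContinuousLinearMap.fst ℝ X (ℕ → U)).prod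
    (ContinuousLinearMap.pi fun k : Fin M =>
      ContinuousLinearMap.proj (k : ℕ) ∘L ContinuousLinearMap.snd ℝ X (ℕ → U))

/-- Extension of an input sequence of length `M` by zero. -/
def extendInputs (M : ℕ) : X × (Fin M → U) →L[ℝ] X × (ℕ → U) :=
  (ContinuousLinearMap.fst ℝ X (Fin M → U)).prod
    (ContinuousLinearMap.pi fun k =>
      if h : k < M then
        ContinuousLinearMap.proj (⟨k, h⟩ : Fin M) ∘L ContinuousLinearMap.snd ℝ X (Fin M → U)
      else 0)

theorem extendInputs_snd (M : ℕ) (z : X × (Fin M → U)) (k : ℕ) :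
    (extendInputs M z).2 k = if h : k < M then z.2 ⟨k, h⟩ else 0 := by
  by_cases h : k < M <;> simp only [extendInputs, ContinuousLinearMap.prod_apply,
    ContinuousLinearMap.pi_apply, h, dite_true, dite_false] <;> rfl

theorem linearShift_snd (F : X × U →L[ℝ] X) (p : X × (ℕ → U)) (k : ℕ) :
    (linearShift F p).2 k = p.2 (k + 1) := rfl

theorem HasCoordFDerivAt.shift {g : W → X × (ℕ → U)} {G : W →L[ℝ] X × (ℕ → U)} {w : W}
    (hg : HasCoordFDerivAt g G w) {f : X → U → X} {F : X × U →L[ℝ] X}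
    (hF : HasFDerivAt (fun p : X × U => f p.1 p.2) F ((g w).1, (g w).2 0)) :
    HasCoordFDerivAt (fun z => _root_.shift f (g z)) (linearShift F ∘L G) w :=
  ⟨HasFDerivAt.comp (g := fun p : X × U => f p.1 p.2) w hF (hg.1.prodMk (hg.2 0)),
    fun k => hg.2 (k + 1)⟩

theorem HasCoordFDerivAt.iterate_shift {g : W → X × (ℕ → U)} {G : W →L[ℝ] X × (ℕ → U)} {w : W}
    (hg : HasCoordFDerivAt g G w) {f : X → U → X} {F : X × U →L[ℝ] X} {x₀ : X} {u₀ : U}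
    (heq : x₀ = f x₀ u₀) (hw : g w = (x₀, fun _ => u₀))
    (hF : HasFDerivAt (fun p : X × U => f p.1 p.2) F (x₀, u₀)) (α : ℕ) :
    HasCoordFDerivAt (fun z => (_root_.shift f)^[α] (g z)) (((linearShift F) ^ α) ∘L G) w := by
  have hfix : ∀ α : ℕ, (_root_.shift f)^[α] (g w) = (x₀, fun _ => u₀) := fun α => by
    rw [hw]
    exact iterate_fixed (by simp [_root_.shift, ← heq]) α
  induction α with
  | zero => exact hg
  | succ α ih =>
    simp only [iterate_succ_apply', pow_succ']
    exact ih.shift (by rw [hfix]; exact hF)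

theorem HasCoordFDerivAt.comp_restrictInputs {g : W → X × (ℕ → U)} {G : W →L[ℝ] X × (ℕ → U)}
    {w : W} (hg : HasCoordFDerivAt g G w) {M : ℕ} {ψ : X × (Fin M → U) → Y}
    {P : X × (Fin M → U) →L[ℝ] Y} (hψ : HasFDerivAt ψ P (restrictInputs (X := X) M (g w))) :
    HasFDerivAt (fun z => ψ (restrictInputs (X := X) M (g z))) (P ∘L restrictInputs M ∘L G) w :=
  hψ.comp w (hg.1.prodMk (hasFDerivAt_pi.2 fun k : Fin M => hg.2 k))

theorem linearOutput_iterate_congr (F : X × U →L[ℝ] X) {q : ℕ} (P : X × (Fin (q + 1) → U) →L[ℝ] Y)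
    (α : ℕ) {p p' : X × (ℕ → U)} (h1 : p.1 = p'.1) (h2 : ∀ j < q + α + 1, p.2 j = p'.2 j) :
    P (restrictInputs (q + 1) ((linearShift F)^[α] p)) =
      P (restrictInputs (q + 1) ((linearShift F)^[α] p')) := by
  induction α generalizing p p' with
  | zero =>
    exact congrArg P (Prod.ext h1 (funext fun k => h2 k k.2))
  | succ α ih =>
    refine ih ?_ fun j hj => h2 (j + 1) (by lia)
    exact congrArg F (Prod.ext h1 (h2 0 (by lia)))

theorem contDiff_iterate_shift {f : X → U → X}
    (hf : ContDiff ℝ (⊤ : ℕ∞) fun p : X × U => f p.1 p.2) {g : W → X × (ℕ → U)}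
    (h1 : ContDiff ℝ (⊤ : ℕ∞) fun z => (g z).1)
    (h2 : ∀ k, ContDiff ℝ (⊤ : ℕ∞) fun z => (g z).2 k) (α : ℕ) :
    ContDiff ℝ (⊤ : ℕ∞) (fun z => ((shift f)^[α] (g z)).1) ∧
      ∀ k, ContDiff ℝ (⊤ : ℕ∞) fun z => ((shift f)^[α] (g z)).2 k := by
  induction α generalizing g with
  | zero => exact ⟨h1, h2⟩
  | succ α ih =>
    exact ih (g := fun z => shift f (g z)) (hf.comp (h1.prodMk (h2 0))) fun k => h2 (k + 1)

end Calculus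

/-- If `y = φ(x,u,u_[1],…,u_[q])` is a flat output of a flat
discrete-time system `x⁺ = f(x,u)`, then for every `β ≥ 0` the `m(β+1)`
functions `φ, δ_{xu}(φ), …, δ_{xu}^β(φ)` are functionally independent: their
combined Jacobian with respect to the variables `(x, u, u_[1], …, u_[q+β])`
(on which alone they depend) has full row rank `m(β+1)`, i.e. the derivative of
the combined map is surjective (near the equilibrium point). -/
theorem flat_output_shifts_functionally_independent {n m : ℕ}
    (f : (Fin n → ℝ) → (Fin m → ℝ) → (Fin n → ℝ))
    (hf : ContDiff ℝ (⊤ : ℕ∞) fun p : (Fin n → ℝ) × (Fin m → ℝ) => f p.1 p.2)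
    (hsub : ∀ x u, Function.Surjective
      (fderiv ℝ (fun p : (Fin n → ℝ) × (Fin m → ℝ) => f p.1 p.2) (x, u)))
    (x₀ : Fin n → ℝ) (u₀ : Fin m → ℝ) (heq : x₀ = f x₀ u₀)
    -- `φ` is the flat output, a smooth function of `(x, u, …, u_[q])`:
    (φ : (Fin n → ℝ) × (ℕ → Fin m → ℝ) → (Fin m → ℝ)) (q : ℕ)
    (ψ : (Fin n → ℝ) × (Fin (q + 1) → Fin m → ℝ) → (Fin m → ℝ))
    (hψ : ContDiff ℝ (⊤ : ℕ∞) ψ)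
    (hφψ : ∀ p, φ p = ψ (p.1, fun j => p.2 j))
    (hflat : IsFlatOutput f x₀ u₀ φ) :
    ∀ β : ℕ,
      ∀ᶠ z in 𝓝 ((x₀, fun _ => u₀) : (Fin n → ℝ) × (Fin (q + β + 1) → Fin m → ℝ)),
        Function.Surjective
          (fderiv ℝ
            (fun z' : (Fin n → ℝ) × (Fin (q + β + 1) → Fin m → ℝ) =>
              (fun α : Fin (β + 1) =>
                φ ((shift f)^[(α : ℕ)]
                  ((z'.1, fun j => if h : j < q + β + 1 then z'.2 ⟨j, h⟩ else u₀) :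
                    (Fin n → ℝ) × (ℕ → Fin m → ℝ)))))
            z) := by
  intro β
  set F := fderiv ℝ (fun p : (Fin n → ℝ) × (Fin m → ℝ) => f p.1 p.2) (x₀, u₀)
  have hF : HasFDerivAt (fun p : (Fin n → ℝ) × (Fin m → ℝ) => f p.1 p.2) F (x₀, u₀) :=
    (hf.differentiable (by simp)).differentiableAt.hasFDerivAt
  set P := fderiv ℝ ψ (x₀, fun _ => u₀)
  have hP : HasFDerivAt ψ P (x₀, fun _ => u₀) :=
    (hψ.differentiable (by simp)).differentiableAt.hasFDerivAt
  set L := P ∘L restrictInputs (X := Fin n → ℝ) (U := Fin m → ℝ) (q + 1) with hL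
  have hφ : φ = fun p => ψ (restrictInputs (q + 1) p) := funext hφψ
  have hfix : ∀ α : ℕ, (shift f)^[α] (x₀, fun _ => u₀) = (x₀, fun _ => u₀) :=
    iterate_fixed (by simp [shift, ← heq])
  -- Linearization of the shifted outputs along a map through the equilibrium.
  have hder : ∀ {W : Type} [NormedAddCommGroup W] [NormedSpace ℝ W]
      {g : W → (Fin n → ℝ) × (ℕ → Fin m → ℝ)} {G : W →L[ℝ] (Fin n → ℝ) × (ℕ → Fin m → ℝ)} {w : W},
      HasCoordFDerivAt g G w → g w = (x₀, fun _ => u₀) → ∀ α : ℕ,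
      HasFDerivAt (fun z => φ ((shift f)^[α] (g z))) (L ∘L ((linearShift F) ^ α) ∘L G) w := by
    intro W _ _ g G w hg hw α
    rw [hφ]
    refine (hg.iterate_shift heq hw hF α).comp_restrictInputs ?_
    simp only [hw, hfix]
    exact hP
  obtain ⟨-, N, E, hE, hev⟩ := hflat
  have hrec : ∀ p, (∀ α < N, L ((linearShift F)^[α] p) = 0) → p.2 0 = 0 := by
    intro p hp
    let g : ℝ → (Fin n → ℝ) × (ℕ → Fin m → ℝ) := fun t => (x₀, fun _ => u₀) + t • p
    have hg0 : g 0 = (x₀, fun _ => u₀) := by simp [g]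
    have hgc : Continuous g := by fun_prop
    have hg : HasCoordFDerivAt g (ContinuousLinearMap.toSpanSingleton ℝ p) 0 :=
      ⟨((ContinuousLinearMap.toSpanSingleton ℝ p.1).hasFDerivAt.const_add x₀),
        fun k => (ContinuousLinearMap.toSpanSingleton ℝ (p.2 k)).hasFDerivAt.const_add u₀⟩
    have hout : HasFDerivAt (fun t => fun α : Fin N => φ ((shift f)^[(α : ℕ)] (g t)))
        (0 : ℝ →L[ℝ] Fin N → Fin m → ℝ) 0 := by
      refine hasFDerivAt_pi'.2 fun α : Fin N => (hder hg hg0 α).congr_fderiv ?_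
      ext
      simp [hp α α.2]
    have hEd := ((hE.differentiable (by simp)).differentiableAt.hasFDerivAt).comp (0 : ℝ) hout
    have hev' := (hgc.tendsto' 0 _ hg0).eventually hev
    have h1 := (hEd.congr_of_eventuallyEq (hev'.mono fun t ht => ht.symm)).snd
    have h2 := congrArg (fun A : ℝ →L[ℝ] Fin m → ℝ => A 1) ((hg.2 0).unique h1)
    simpa using h2
  have hsurj := surjective_pi_shifts_of_input_reconstructible (linearShift F).toLinearMap
    (linearShift_snd F) L.toLinearMap N hrec (β + 1)
  let g : (Fin n → ℝ) × (Fin (q + β + 1) → Fin m → ℝ) → (Fin n → ℝ) × (ℕ → Fin m → ℝ) :=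
    fun z' => (z'.1, fun j => if h : j < q + β + 1 then z'.2 ⟨j, h⟩ else u₀)
  have hg0 : g (x₀, fun _ => u₀) = (x₀, fun _ => u₀) := by simp [g]
  have hgext : ∀ z k, (g z).2 k =
      (if k < q + β + 1 then 0 else u₀) + (extendInputs (q + β + 1) z).2 k := by
    intro z k
    rw [extendInputs_snd]
    by_cases h : k < q + β + 1 <;> simp only [g, h, dite_true, dite_false, if_true, if_false,
      zero_add, add_zero]
  have hg : HasCoordFDerivAt g (extendInputs (q + β + 1)) (x₀, fun _ => u₀) := by
    refine ⟨hasFDerivAt_fst, fun k => ?_⟩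
    simp only [hgext]
    exact (ContinuousLinearMap.hasFDerivAt _).const_add _
  have hgs : ∀ k, ContDiff ℝ (⊤ : ℕ∞) fun z => (g z).2 k := by
    intro k
    simp only [hgext]
    exact contDiff_const.add (ContinuousLinearMap.contDiff (ContinuousLinearMap.proj k ∘L
      ContinuousLinearMap.snd ℝ (Fin n → ℝ) (ℕ → Fin m → ℝ) ∘L extendInputs (q + β + 1)))
  have hsmooth : ContDiff ℝ (⊤ : ℕ∞)
      (fun z => fun α : Fin (β + 1) => φ ((shift f)^[(α : ℕ)] (g z))) := by
    refine contDiff_pi.2 fun α => ?_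
    have h := contDiff_iterate_shift hf (g := g) contDiff_fst hgs α
    rw [hφ]
    exact hψ.comp (h.1.prodMk (contDiff_pi.2 fun k => h.2 k))
  refine ((hsmooth.continuous_fderiv (by simp)).tendsto _).eventually
    (ContinuousLinearMap.eventually_surjective ?_)
  rw [(hasFDerivAt_pi.2 fun α : Fin (β + 1) => hder hg hg0 α).fderiv]
  intro y
  obtain ⟨p, hp⟩ := hsurj y
  refine ⟨restrictInputs (q + β + 1) p, ?_⟩
  rw [← hp]
  funext α
  have := linearOutput_iterate_congr F P α (p := extendInputs (q + β + 1)
    (restrictInputs (q + β + 1) p)) (p' := p) rfl fun j hj => by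
      rw [extendInputs_snd, dif_pos (by have := α.2; lia)]
      rfl
  simpa [hL, Module.End.coe_pow] using this
end
end

section
/- Let y = φ(x, u, u_[1], …, u_[q]) be a flat output of a flat discrete-time system x⁺ = f(x,u) with parametrization x = F_x(y_[0,R−1]), u = F_u(y_[0,R]). Then (i) the map (x, u) = F(y_[0,R]) given by this parametrization is a submersion (the rows of its Jacobian matrix are linearly independent), and (ii) the map (y, y_[1], …, y_[R]) = (φ, δ_{xu}(φ), …, δ_{xu}^R(φ)) of (x, u, u_[1], …) is also a submersion. -/
/-!
Discrete-time systems `x⁺ = f(x,u)` and difference flatness, following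
Kolar–Schöberl–Diwold, "Differential-Geometric Decomposition of Flat Nonlinear
Discrete-Time Systems".
-/

open Filter Topology Function

noncomputable section

/-- Over a domain, a family is linearly independent as soon as its span contains a linearly
independent family with the same finite index type. -/
theorem linearIndependent_of_mem_span_range {ι R M : Type*} [Fintype ι] [CommRing R] [IsDomain R]
    [AddCommGroup M] [Module R M] {u y : ι → M} (hu : LinearIndependent R u)
    (h : ∀ i, u i ∈ Submodule.span R (Set.range y)) : LinearIndependent R y := by
  classical
  obtain ⟨G, hG⟩ : ∃ G : Matrix ι ι R, ∀ i, ∑ j, G i j • y j = u i :=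
    Classical.skolem.1 fun i => (Submodule.mem_span_range_iff_exists_fun R).1 (h i)
  have hvec (c : ι → R) : ∑ i, c i • u i = ∑ j, (Matrix.vecMul c G) j • y j := by
    simp_rw [← hG, Matrix.vecMul, dotProduct, Finset.smul_sum, Finset.sum_smul, smul_smul]
    exact Finset.sum_comm
  rw [Fintype.linearIndependent_iff] at hu ⊢
  have hdet : Matrix.det G ≠ 0 := by
    intro h0
    obtain ⟨c, hc, hcG⟩ := Matrix.exists_vecMul_eq_zero_iff.2 h0
    exact hc (funext (hu c (by simp [hvec, hcG])))
  intro c hc j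
  have hadj : Matrix.vecMul (Matrix.vecMul c (Matrix.adjugate G)) G = Matrix.det G • c := by
    rw [Matrix.vecMul_vecMul, Matrix.adjugate_mul, Matrix.vecMul_smul, Matrix.vecMul_one]
  have hzero : Matrix.vecMul c (Matrix.adjugate G) = 0 :=
    funext (hu _ (by simp [hvec, hadj, mul_smul, ← Finset.smul_sum, hc]))
  rw [hzero, Matrix.zero_vecMul] at hadj
  simpa [hdet] using (congrFun hadj j).symm

/-- A family in `M` is linearly independent over `K[X]`, with `X` acting as the endomorphism `T`,
if and only if all its images under the powers of `T` are linearly independent over `K`. -/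
theorem linearIndependent_aeval'_of_iff {ι K M : Type*} [Field K] [AddCommGroup M]
    [Module K M] (T : Module.End K M) (y : ι → M) :
    LinearIndependent (Polynomial K) (fun i => Module.AEval'.of T (y i)) ↔
      LinearIndependent K fun i : ℕ × ι => (T ^ i.1) (y i.2) := by
  have hbasis (k : ℕ) : Polynomial.basisMonomials K k = Polynomial.X ^ k := by
    simp [Polynomial.X_pow_eq_monomial]
  constructor
  · intro h
    have := linearIndependent_smul (Polynomial.basisMonomials K).linearIndependent h
    simp_rw [hbasis, Module.AEval'.X_pow_smul_of] at this
    exact LinearIndependent.of_comp (Module.AEval'.of T).toLinearMap this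
  · intro h
    rw [linearIndependent_iff'] at h ⊢
    intro s p hp i hi
    ext k
    by_cases hk : k ∈ Finset.range (s.sup fun i => (p i).natDegree + 1)
    · refine h (Finset.range (s.sup fun i => (p i).natDegree + 1) ×ˢ s)
        (fun a => (p a.2).coeff a.1) ?_ (k, i) (by simp [hi, Finset.mem_range.1 hk])
      rw [Finset.sum_product_right]
      apply (Module.AEval'.of T).injective
      rw [map_zero, ← hp, map_sum]
      refine Finset.sum_congr rfl fun j hj => ?_
      rw [← Module.AEval.of_aeval_smul, Polynomial.aeval_eq_sum_range'
        (n := s.sup fun i => (p i).natDegree + 1)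
        (Nat.lt_of_succ_le (Finset.le_sup (f := fun i => (p i).natDegree + 1) hj))]
      simp [Finset.sum_smul, Module.AEval']
    · refine Polynomial.coeff_eq_zero_of_natDegree_lt ?_
      have := Finset.le_sup (f := fun i => (p i).natDegree + 1) hi
      simp only [Finset.mem_range] at hk
      omega

/-- If the orbits under `T` of the members of `u` are jointly independent and `u` lies in the span of
the orbits of the equally many members of `y`, then these orbits are jointly independent too. -/
theorem linearIndependent_pow_of_mem_span {ι K M : Type*} [Fintype ι] [Field K] [AddCommGroup M]
    [Module K M] (T : Module.End K M) {u y : ι → M}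
    (hu : LinearIndependent K fun i : ℕ × ι => (T ^ i.1) (u i.2))
    (h : ∀ i, u i ∈ Submodule.span K (Set.range fun i : ℕ × ι => (T ^ i.1) (y i.2))) :
    LinearIndependent K fun i : ℕ × ι => (T ^ i.1) (y i.2) := by
  rw [← linearIndependent_aeval'_of_iff] at hu ⊢
  refine linearIndependent_of_mem_span_range hu fun i => ?_
  suffices Submodule.span K (Set.range fun i : ℕ × ι => (T ^ i.1) (y i.2)) ≤
      ((Submodule.span (Polynomial K)
        (Set.range fun i => Module.AEval'.of T (y i))).restrictScalars K).comap
          (Module.AEval'.of T).toLinearMap from this (h i)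
  rw [Submodule.span_le]
  rintro _ ⟨⟨k, j⟩, rfl⟩
  have := Submodule.smul_mem _ (Polynomial.X ^ k : Polynomial K) (Submodule.subset_span
    (R := Polynomial K) (Set.mem_range_self (f := fun i => Module.AEval'.of T (y i)) j))
  rwa [Module.AEval'.X_pow_smul_of] at this

/-- Surjectivity of the derivative is an open condition. -/
theorem eventually_surjective_fderiv {E F : Type*} [NormedAddCommGroup E] [NormedSpace ℝ E]
    [NormedAddCommGroup F] [NormedSpace ℝ F] [FiniteDimensional ℝ F] {g : E → F} {z₀ : E}
    (hg : ContDiff ℝ (⊤ : ℕ∞) g) (h : Surjective (fderiv ℝ g z₀)) :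
    ∀ᶠ z in 𝓝 z₀, Surjective (fderiv ℝ g z) := by
  obtain ⟨B, hB⟩ := (fderiv ℝ g z₀).exists_rightInverse_of_surjective
    (LinearMap.range_eq_top.2 h)
  have : CompleteSpace F := FiniteDimensional.complete ℝ F
  have hcont : Continuous fun z => (fderiv ℝ g z).comp B :=
    (hg.continuous_fderiv (by simp)).clm_comp continuous_const
  have hmem : {A : F →L[ℝ] F | IsUnit A} ∈ 𝓝 ((fderiv ℝ g z₀).comp B) :=
    Units.isOpen.mem_nhds (by rw [hB]; exact isUnit_one)
  filter_upwards [hcont.continuousAt hmem] with z hz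
  obtain ⟨A, hA⟩ := hz
  refine Surjective.of_comp (g := B) fun w => ⟨(↑A⁻¹ : F →L[ℝ] F) w, ?_⟩
  have hAw : ((A : F →L[ℝ] F) * (↑A⁻¹ : F →L[ℝ] F)) w = w := by simp
  rwa [hA] at hAw

theorem snd_shift_iterate {X U : Type*} (f : X → U → X) (k : ℕ) (p : X × (ℕ → U)) (j : ℕ) :
    ((shift f)^[k] p).2 j = p.2 (j + k) := by
  induction k generalizing j with
  | zero => rfl
  | succ k ih =>
    rw [iterate_succ_apply']
    change ((shift f)^[k] p).2 (j + 1) = _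
    rw [ih, add_right_comm, add_assoc]

theorem shift_iterate_equilibrium {X U : Type*} {f : X → U → X} {x₀ : X} {u₀ : U}
    (heq : x₀ = f x₀ u₀) (k : ℕ) :
    (shift f)^[k] (x₀, fun _ => u₀) = (x₀, fun _ => u₀) := by
  apply iterate_fixed
  simp [shift, ← heq]

/-- The state after `k` steps depends only on the first `k` inputs. -/
theorem fst_shift_iterate_congr {X U : Type*} (f : X → U → X) {p p' : X × (ℕ → U)} {k : ℕ}
    (h₁ : p.1 = p'.1) (h₂ : ∀ i < k, p.2 i = p'.2 i) :
    ((shift f)^[k] p).1 = ((shift f)^[k] p').1 := by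
  induction k with
  | zero => exact h₁
  | succ k ih =>
    rw [iterate_succ_apply', iterate_succ_apply']
    change f ((shift f)^[k] p).1 (((shift f)^[k] p).2 0) =
      f ((shift f)^[k] p').1 (((shift f)^[k] p').2 0)
    rw [ih fun i hi => h₂ i (by omega), snd_shift_iterate, snd_shift_iterate, h₂ _ (by omega)]

/-- The linearization of the forward shift along a linear approximation `L` of the dynamics. -/
def linShift {X U : Type*} [NormedAddCommGroup X] [NormedSpace ℝ X] [NormedAddCommGroup U]
    [NormedSpace ℝ U] (L : X × U →L[ℝ] X) : Module.End ℝ (X × (ℕ → U)) where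
  toFun v := (L (v.1, v.2 0), fun k => v.2 (k + 1))
  map_add' v w := by
    ext1
    · exact L.map_add (v.1, v.2 0) (w.1, w.2 0)
    · rfl
  map_smul' a v := by
    ext1
    · exact L.map_smul a (v.1, v.2 0)
    · rfl

/-- The curve `c` in the space with coordinates `(x, u, u_[1], …)` has velocity `v` at time `0`. -/
def HasVelocity {X U : Type*} [NormedAddCommGroup X] [NormedSpace ℝ X] [NormedAddCommGroup U]
    [NormedSpace ℝ U] (c : ℝ → X × (ℕ → U)) (v : X × (ℕ → U)) : Prop :=
  HasDerivAt (fun t => (c t).1) v.1 0 ∧ ∀ k, HasDerivAt (fun t => (c t).2 k) (v.2 k) 0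

section Velocity

variable {X U : Type*} [NormedAddCommGroup X] [NormedSpace ℝ X] [NormedAddCommGroup U]
  [NormedSpace ℝ U] {f : X → U → X} {L : X × U →L[ℝ] X} {x₀ : X} {u₀ : U}
  {c : ℝ → X × (ℕ → U)} {v : X × (ℕ → U)}

theorem hasVelocity_line (p v : X × (ℕ → U)) : HasVelocity (fun t => p + t • v) v := by
  refine ⟨?_, fun k => ?_⟩
  · simpa using ((hasDerivAt_id (0 : ℝ)).smul_const v.1).const_add p.1
  · simpa using ((hasDerivAt_id (0 : ℝ)).smul_const (v.2 k)).const_add (p.2 k)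

theorem snd_linShift_pow (L : X × U →L[ℝ] X) (k : ℕ) (v : X × (ℕ → U)) (j : ℕ) :
    ((linShift L ^ k) v).2 j = v.2 (j + k) := by
  induction k generalizing j with
  | zero => rfl
  | succ k ih =>
    rw [pow_succ', Module.End.mul_apply]
    change ((linShift L ^ k) v).2 (j + 1) = _
    rw [ih, add_right_comm, add_assoc]

theorem HasVelocity.shift_iterate (hf : HasFDerivAt (fun p : X × U => f p.1 p.2) L (x₀, u₀))
    (heq : x₀ = f x₀ u₀) (hc₀ : c 0 = (x₀, fun _ => u₀)) (hc : HasVelocity c v) (k : ℕ) :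
    HasVelocity (fun t => (shift f)^[k] (c t)) ((linShift L ^ k) v) := by
  induction k with
  | zero => exact hc
  | succ k ih =>
    simp_rw [iterate_succ_apply']
    rw [pow_succ', Module.End.mul_apply]
    refine ⟨?_, fun j => ih.2 (j + 1)⟩
    refine HasFDerivAt.comp_hasDerivAt_of_eq (0 : ℝ) hf (ih.1.prodMk (ih.2 0)) ?_
    simp only [hc₀, shift_iterate_equilibrium heq]

/-- The linearization at the equilibrium of a function of `(x, u, …, u_[q])`. -/
def linOutput {Y : Type*} [NormedAddCommGroup Y] [NormedSpace ℝ Y] {q : ℕ}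
    (P : X × (Fin (q + 1) → U) →L[ℝ] Y) : X × (ℕ → U) →ₗ[ℝ] Y :=
  P.toLinearMap ∘ₗ LinearMap.prodMap LinearMap.id (LinearMap.funLeft ℝ U Fin.val)

theorem HasVelocity.output {Y : Type*} [NormedAddCommGroup Y] [NormedSpace ℝ Y] {q : ℕ}
    {ψ : X × (Fin (q + 1) → U) → Y} {P : X × (Fin (q + 1) → U) →L[ℝ] Y}
    (hψ : HasFDerivAt ψ P (x₀, fun _ => u₀)) (hc₀ : c 0 = (x₀, fun _ => u₀))
    (hc : HasVelocity c v) :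
    HasDerivAt (fun t => ψ ((c t).1, fun k => (c t).2 k)) (linOutput P v) 0 := by
  refine HasFDerivAt.comp_hasDerivAt_of_eq (0 : ℝ) hψ
    (hc.1.prodMk (hasDerivAt_pi.2 fun k : Fin (q + 1) => hc.2 k)) ?_
  rw [hc₀]

theorem contDiff_fst_shift_iterate {E : Type*} [NormedAddCommGroup E] [NormedSpace ℝ E]
    {r : WithTop ℕ∞} (hf : ContDiff ℝ r fun p : X × U => f p.1 p.2) {g : E → X × (ℕ → U)}
    (hg₁ : ContDiff ℝ r fun z => (g z).1) (hg₂ : ∀ k, ContDiff ℝ r fun z => (g z).2 k) (k : ℕ) :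
    ContDiff ℝ r fun z => ((shift f)^[k] (g z)).1 := by
  induction k with
  | zero => exact hg₁
  | succ k ih =>
    simp_rw [iterate_succ_apply']
    change ContDiff ℝ r fun z => f ((shift f)^[k] (g z)).1 (((shift f)^[k] (g z)).2 0)
    simp_rw [snd_shift_iterate]
    exact hf.comp (ih.prodMk (hg₂ _))

end Velocity

theorem LinearMap.dualMap_pow_apply {K V : Type*} [CommSemiring K] [AddCommMonoid V] [Module K V]
    (S : Module.End K V) (k : ℕ) (y : Module.Dual K V) (v : V) :
    ((S.dualMap : Module.End K (Module.Dual K V)) ^ k) y v = y ((S ^ k) v) := by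
  induction k generalizing v with
  | zero => rfl
  | succ k ih =>
    rw [pow_succ', Module.End.mul_apply, LinearMap.dualMap_apply, ih, pow_succ,
      Module.End.mul_apply]

theorem LinearMap.apply_eq_sum_single {ι : Type*} [Fintype ι] [DecidableEq ι] {κ : ι → Type*}
    [∀ i, Fintype (κ i)] [∀ i, DecidableEq (κ i)] {K M : Type*} [CommSemiring K] [AddCommMonoid M]
    [Module K M] (ℓ : (∀ i, κ i → K) →ₗ[K] M) (z : ∀ i, κ i → K) :
    ℓ z = ∑ i, ∑ a, z i a • ℓ (Pi.single i (Pi.single a 1)) := by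
  conv_lhs => rw [← Finset.univ_sum_single z]
  rw [map_sum]
  refine Finset.sum_congr rfl fun i _ => ?_
  conv_lhs => rw [← Finset.univ_sum_single (z i)]
  rw [← LinearMap.coe_single K, map_sum, map_sum]
  refine Finset.sum_congr rfl fun a _ => ?_
  rw [← map_smul, ← map_smul, ← Pi.single_smul, smul_eq_mul, mul_one]

/-- Let `y = φ` be a flat output of `x⁺ = f(x,u)` with
parametrization `x = F_x(y_[0,R−1])`, `u = F_u(y_[0,R])`.  Then
(i) the combined parametrization map `(x,u) = F(y_[0,R])` is a submersion, and
(ii) the map `(y, y_[1], …, y_[R]) = (φ, δ_{xu}φ, …, δ_{xu}^R φ)`, viewed as a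
function of the variables `(x, u, u_[1], …)` on which it depends, is a
submersion (both near the respective points corresponding to the
equilibrium). -/
theorem flat_parametrization_is_submersion {n m : ℕ}
    (f : (Fin n → ℝ) → (Fin m → ℝ) → (Fin n → ℝ))
    (hf : ContDiff ℝ (⊤ : ℕ∞) fun p : (Fin n → ℝ) × (Fin m → ℝ) => f p.1 p.2)
    (hsub : ∀ x u, Function.Surjective
      (fderiv ℝ (fun p : (Fin n → ℝ) × (Fin m → ℝ) => f p.1 p.2) (x, u)))
    (x₀ : Fin n → ℝ) (u₀ : Fin m → ℝ) (heq : x₀ = f x₀ u₀)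
    -- the flat output, a smooth function of `(x, u, …, u_[q])`:
    (φ : (Fin n → ℝ) × (ℕ → Fin m → ℝ) → (Fin m → ℝ)) (q : ℕ)
    (ψ : (Fin n → ℝ) × (Fin (q + 1) → Fin m → ℝ) → (Fin m → ℝ))
    (hψ : ContDiff ℝ (⊤ : ℕ∞) ψ)
    (hφψ : ∀ p, φ p = ψ (p.1, fun j => p.2 j))
    (hflat : IsFlatOutput f x₀ u₀ φ)
    -- the parametrization `x = F_x(y_[0,R−1])`, `u = F_u(y_[0,R])`:
    (R : Fin m → ℕ)
    (Fx : ((j : Fin m) → Fin (R j) → ℝ) → (Fin n → ℝ))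
    (Fu : ((j : Fin m) → Fin (R j + 1) → ℝ) → (Fin m → ℝ))
    (hFx : ContDiff ℝ (⊤ : ℕ∞) Fx) (hFu : ContDiff ℝ (⊤ : ℕ∞) Fu)
    (hpar : ∀ᶠ p in 𝓝 ((x₀, fun _ => u₀) : (Fin n → ℝ) × (ℕ → Fin m → ℝ)),
      Fx (fun j (α : Fin (R j)) => φ ((shift f)^[(α : ℕ)] p) j) = p.1 ∧
      Fu (fun j (α : Fin (R j + 1)) => φ ((shift f)^[(α : ℕ)] p) j) = p.2 0) :
    -- (i) `F = (F_x, F_u)` is a submersion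
    (∀ᶠ z in 𝓝 ((fun j (α : Fin (R j + 1)) =>
        φ ((shift f)^[(α : ℕ)]
          ((x₀, fun _ => u₀) : (Fin n → ℝ) × (ℕ → Fin m → ℝ))) j) :
        (j : Fin m) → Fin (R j + 1) → ℝ),
      Function.Surjective
        (fderiv ℝ
          (fun z' : (j : Fin m) → Fin (R j + 1) → ℝ =>
            ((Fx fun j (α : Fin (R j)) => z' j α.castSucc, Fu z') :
              (Fin n → ℝ) × (Fin m → ℝ)))
          z)) ∧
    -- (ii) `(φ, δ_{xu}φ, …, δ_{xu}^R φ)` is a submersion in the variables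
    -- `(x, u, u_[1], …, u_[q + max R])`
    (∀ᶠ z in 𝓝 ((x₀, fun _ => u₀) :
        (Fin n → ℝ) × (Fin (q + Finset.univ.sup R + 1) → Fin m → ℝ)),
      Function.Surjective
        (fderiv ℝ
          (fun z' : (Fin n → ℝ) × (Fin (q + Finset.univ.sup R + 1) → Fin m → ℝ) =>
            (fun j (α : Fin (R j + 1)) =>
              φ ((shift f)^[(α : ℕ)]
                ((z'.1, fun j' =>
                  if h : j' < q + Finset.univ.sup R + 1 then z'.2 ⟨j', h⟩ else u₀) :
                  (Fin n → ℝ) × (ℕ → Fin m → ℝ))) j :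
              (j : Fin m) → Fin (R j + 1) → ℝ))
          z)) := by
  classical
  have hfd := (hf.differentiable (by simp) (x₀, u₀)).hasFDerivAt
  have hψd := (hψ.differentiable (by simp) (x₀, fun _ => u₀)).hasFDerivAt
  set S := linShift (fderiv ℝ (fun p : (Fin n → ℝ) × (Fin m → ℝ) => f p.1 p.2) (x₀, u₀))
  set lin := linOutput (fderiv ℝ ψ (x₀, fun _ => u₀))
  set p₀ : (Fin n → ℝ) × (ℕ → Fin m → ℝ) := (x₀, fun _ => u₀) with hp₀
  have houtput {c : ℝ → (Fin n → ℝ) × (ℕ → Fin m → ℝ)} {v} (hc₀ : c 0 = p₀)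
      (hc : HasVelocity c v) :
      HasDerivAt (fun t j (α : Fin (R j + 1)) => φ ((shift f)^[(α : ℕ)] (c t)) j)
        (fun j (α : Fin (R j + 1)) => lin ((S ^ (α : ℕ)) v) j) 0 := by
    refine hasDerivAt_pi.2 fun j => hasDerivAt_pi.2 fun α => ?_
    simp_rw [hφψ]
    refine hasDerivAt_pi.1 ((hc.shift_iterate hfd heq hc₀ α).output hψd ?_) j
    rw [hc₀, shift_iterate_equilibrium heq]
  set F := fun z' : (j : Fin m) → Fin (R j + 1) → ℝ =>
    ((Fx fun j (α : Fin (R j)) => z' j α.castSucc, Fu z') : (Fin n → ℝ) × (Fin m → ℝ))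
  set z₀ := (fun j (α : Fin (R j + 1)) => φ ((shift f)^[(α : ℕ)] p₀) j)
  have hF : ContDiff ℝ (⊤ : ℕ∞) F := by
    refine (hFx.comp ?_).prodMk hFu
    exact contDiff_pi.2 fun j => contDiff_pi.2 fun α =>
      contDiff_pi.1 (contDiff_pi.1 contDiff_id j) α.castSucc
  have hFlin (v : (Fin n → ℝ) × (ℕ → Fin m → ℝ)) :
      fderiv ℝ F z₀ (fun j (α : Fin (R j + 1)) => lin ((S ^ (α : ℕ)) v) j) = (v.1, v.2 0) := by
    have hline := hasVelocity_line p₀ v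
    have hcomp := HasFDerivAt.comp_hasDerivAt_of_eq (0 : ℝ)
      (hF.differentiable (by simp) z₀).hasFDerivAt (houtput (by simp) hline) (by simp [z₀])
    refine hcomp.unique ((hline.1.prodMk (hline.2 0)).congr_of_eventuallyEq ?_)
    have hcont : Tendsto (fun t : ℝ => p₀ + t • v) (𝓝 0) (𝓝 p₀) := by
      have : Continuous fun t : ℝ => p₀ + t • v := by fun_prop
      simpa using this.tendsto 0
    filter_upwards [hcont.eventually hpar] with t ht
    exact Prod.ext ht.1 ht.2
  refine ⟨eventually_surjective_fderiv hF fun w => ⟨_, hFlin (w.1, fun _ => w.2)⟩, ?_⟩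
  set ext := fun z' : (Fin n → ℝ) × (Fin (q + Finset.univ.sup R + 1) → Fin m → ℝ) =>
    ((z'.1, fun j' => if h : j' < q + Finset.univ.sup R + 1 then z'.2 ⟨j', h⟩ else u₀) :
      (Fin n → ℝ) × (ℕ → Fin m → ℝ)) with hext
  have hext_smooth (k : ℕ) : ContDiff ℝ (⊤ : ℕ∞) fun z' => (ext z').2 k := by
    by_cases h : k < q + Finset.univ.sup R + 1
    · simp only [hext, h, dite_true]
      fun_prop
    · simp only [hext, h, dite_false]
      exact contDiff_const
  have hΦ : ContDiff ℝ (⊤ : ℕ∞) fun z' j (α : Fin (R j + 1)) =>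
      φ ((shift f)^[(α : ℕ)] (ext z')) j := by
    refine contDiff_pi.2 fun j => contDiff_pi.2 fun α => ?_
    simp_rw [hφψ, snd_shift_iterate]
    exact contDiff_pi.1 (hψ.comp
      ((contDiff_fst_shift_iterate (g := ext) hf contDiff_fst hext_smooth α).prodMk
        (contDiff_pi.2 fun k : Fin (q + 1) => hext_smooth (k + α)))) j
  refine eventually_surjective_fderiv hΦ ?_
  have hΦlin (v : (Fin n → ℝ) × (ℕ → Fin m → ℝ)) :
      fderiv ℝ (fun z' j (α : Fin (R j + 1)) => φ ((shift f)^[(α : ℕ)] (ext z')) j)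
        (x₀, fun _ => u₀) (v.1, fun k => v.2 k) =
      fun j (α : Fin (R j + 1)) => lin ((S ^ (α : ℕ)) v) j := by
    let z₁ : (Fin n → ℝ) × (Fin (q + Finset.univ.sup R + 1) → Fin m → ℝ) := (x₀, fun _ => u₀)
    let w : (Fin n → ℝ) × (Fin (q + Finset.univ.sup R + 1) → Fin m → ℝ) := (v.1, fun k => v.2 k)
    have hline : HasDerivAt (fun t : ℝ => z₁ + t • w) w 0 := by
      simpa using ((hasDerivAt_id (0 : ℝ)).smul_const w).const_add z₁
    refine (HasFDerivAt.comp_hasDerivAt_of_eq (0 : ℝ)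
      (hΦ.differentiable (by simp) _).hasFDerivAt hline (by simp [z₁])).unique
      ((houtput (by simp) (hasVelocity_line p₀ v)).congr_of_eventuallyEq (.of_forall fun t => ?_))
    funext j α
    have hR : R j ≤ Finset.univ.sup R := Finset.le_sup (Finset.mem_univ j)
    have hα := α.is_lt
    have hagree (k : ℕ) (hk : k < q + Finset.univ.sup R + 1) :
        (ext (z₁ + t • w)).2 k = (p₀ + t • v).2 k :=
      dif_pos hk
    simp only [comp_apply, hφψ, snd_shift_iterate]
    refine congrFun (congrArg ψ (Prod.ext ?_ (funext fun k => hagree (k + α) (by omega)))) j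
    exact fst_shift_iterate_congr f rfl fun i hi => hagree i (by omega)
  let T : Module.End ℝ (Module.Dual ℝ ((Fin n → ℝ) × (ℕ → Fin m → ℝ))) := S.dualMap
  let y (j : Fin m) : Module.Dual ℝ ((Fin n → ℝ) × (ℕ → Fin m → ℝ)) := LinearMap.proj j ∘ₗ lin
  let u (i : Fin m) : Module.Dual ℝ ((Fin n → ℝ) × (ℕ → Fin m → ℝ)) :=
    LinearMap.proj i ∘ₗ LinearMap.proj 0 ∘ₗ LinearMap.snd ℝ _ _
  have hTy (k : ℕ) (j : Fin m) (v) : (T ^ k) (y j) v = lin ((S ^ k) v) j :=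
    LinearMap.dualMap_pow_apply S k (y j) v
  have hTu (k : ℕ) (i : Fin m) (v) : (T ^ k) (u i) v = v.2 k i := by
    rw [LinearMap.dualMap_pow_apply]
    change ((S ^ k) v).2 0 i = _
    rw [snd_linShift_pow, zero_add]
  have hu : LinearIndependent ℝ fun i : ℕ × Fin m => (T ^ i.1) (u i.2) := by
    refine linearIndependent_iff'.2 fun s a ha i hi => ?_
    have := LinearMap.congr_fun ha (0, Pi.single i.1 (Pi.single i.2 1))
    rw [LinearMap.sum_apply, Finset.sum_eq_single_of_mem i hi] at this
    · simpa [hTu] using this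
    · intro b _ hb
      rw [LinearMap.smul_apply, hTu]
      by_cases h₁ : b.1 = i.1
      · have h₂ : b.2 ≠ i.2 := fun h₂ => hb (Prod.ext h₁ h₂)
        simp [h₁, h₂]
      · simp [h₁]
  have hspan (i : Fin m) :
      u i ∈ Submodule.span ℝ (Set.range fun i : ℕ × Fin m => (T ^ i.1) (y i.2)) := by
    have : u i = ∑ j, ∑ α : Fin (R j + 1),
        (fderiv ℝ F z₀ (Pi.single j (Pi.single α 1))).2 i • (T ^ (α : ℕ)) (y j) := by
      refine LinearMap.ext fun v => ?_
      have h := congrArg (fun w => w.2 i) (hFlin v)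
      rw [← ContinuousLinearMap.coe_coe, LinearMap.apply_eq_sum_single] at h
      simp only [Prod.snd_sum, Finset.sum_apply, Prod.smul_snd, Pi.smul_apply] at h
      simp only [LinearMap.sum_apply, LinearMap.smul_apply, hTy]
      refine h.symm.trans (Finset.sum_congr rfl fun j _ => Finset.sum_congr rfl fun α _ => ?_)
      exact mul_comm _ _
    rw [this]
    exact Submodule.sum_mem _ fun j _ => Submodule.sum_mem _ fun α _ =>
      Submodule.smul_mem _ _ (Submodule.subset_span ⟨((α : ℕ), j), rfl⟩)
  have hy := (linearIndependent_pow_of_mem_span T hu hspan).comp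
    (fun a : (j : Fin m) × Fin (R j + 1) => ((a.2 : ℕ), a.1)) (by
      rintro ⟨j, α⟩ ⟨j', α'⟩ h
      obtain ⟨h₁, rfl⟩ := Prod.ext_iff.1 h
      exact congrArg _ (Fin.ext h₁))
  rw [← ContinuousLinearMap.coe_coe, ← LinearMap.dualMap_injective_iff,
    ← LinearMap.ker_eq_bot, LinearMap.ker_eq_bot']
  intro ℓ hℓ
  have hzero := Fintype.linearIndependent_iff.1 hy
    (fun a => ℓ (Pi.single a.1 (Pi.single a.2 1))) (by
      refine LinearMap.ext fun v => ?_
      have h := LinearMap.congr_fun hℓ (v.1, fun k => v.2 k)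
      rw [LinearMap.dualMap_apply, ContinuousLinearMap.coe_coe, hΦlin,
        LinearMap.apply_eq_sum_single] at h
      simp only [LinearMap.sum_apply, LinearMap.smul_apply, Fintype.sum_sigma, comp_apply, hTy]
      refine Eq.trans ?_ h
      exact Finset.sum_congr rfl fun j _ => Finset.sum_congr rfl fun α _ => mul_comm _ _)
  refine LinearMap.ext fun z => ?_
  rw [LinearMap.apply_eq_sum_single]
  exact Finset.sum_eq_zero fun j _ => Finset.sum_eq_zero fun α _ => by
    rw [hzero ⟨j, α⟩, smul_zero]
end
end

section
/- Consider a discrete-time system x⁺ = f(x,u) with rank(∂_u f) = m and a choice of m smooth functions h^j(x,u) such that (x,u) ↦ (f(x,u), h(x,u)) =: (x⁺, ξ) is a local diffeomorphism (adapted coordinates). Write the input vector fields ∂_{u^1},…,∂_{u^m} in adapted coordinates and assume (after renumbering the state variables and taking suitable linear combinations) that they form the normalized basis v_k = ∂_{x^{k,+}} + Σ_{i=m+1}^{n} a_k^i(x⁺, ξ) ∂_{x^{i,+}} + Σ_{j=1}^{m} b_k^j(x⁺, ξ) ∂_{ξ^j} for k = 1,…,m. Then a linear combination c^1(x⁺,ξ)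 v₁ + … + c^m(x⁺,ξ) v_m is projectable, i.e., of the form a^i(x⁺) ∂_{x^{i,+}} + b^j(x⁺,ξ) ∂_{ξ^j}, if and only if all coefficients c^1,…,c^m are independent of ξ and satisfy the (n−m)·m algebraic equations c^k(x⁺) ∂_{ξ^j} a_k^i(x⁺,ξ) = 0 for i = m+1,…,n and j = 1,…,m. -/
/-!
Statement 15 (Appendix of Kolar–Schöberl–Diwold): projectability criterion for
linear combinations of the input vector fields in adapted coordinates.

Adapted coordinates on `𝒳 × 𝒰` are `(x⁺, ξ)` with `x⁺ ∈ ℝⁿ`, `ξ ∈ ℝᵐ`, and the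
map `f` becomes the projection onto `x⁺`.  We split `x⁺ = (x⁺₁, x⁺₂)` with
`x⁺₁ ∈ ℝᵐ` (the first `m` state coordinates) and `x⁺₂ ∈ ℝ^{n−m}` (writing
`r = n − m`), so the total space is `P = ((ℝᵐ × ℝʳ)) × ℝᵐ`.  In this setting a
vector field is projectable iff its `x⁺`-components are independent of `ξ`.
The normalized basis of the input distribution is
`v_k = ∂_{x^{k,+}} + Σ_{i>m} a_k^i ∂_{x^{i,+}} + Σ_j b_k^j ∂_{ξ^j}`.
-/

open Filter Topology Function

noncomputable section

/-- The derivative of a linear combination with constant coefficients. -/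
theorem fderiv_sum_const_mul {E ι : Type*} [NormedAddCommGroup E] [NormedSpace ℝ E] [Fintype ι]
    {g : ι → E → ℝ} {y : E} (hg : ∀ k, DifferentiableAt ℝ (g k) y) (γ : ι → ℝ) (e : E) :
    fderiv ℝ (fun ξ => ∑ k, γ k * g k ξ) y e = ∑ k, γ k * fderiv ℝ (g k) y e := by
  have h : HasFDerivAt (fun ξ => ∑ k, γ k * g k ξ) (∑ k, γ k • fderiv ℝ (g k) y) y :=
    HasFDerivAt.fun_sum fun k _ => (hg k).hasFDerivAt.const_mul (γ k)
  simp [h.fderiv]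

/-- A differentiable function on `ℝᵐ` whose partial derivatives all vanish is constant. -/
theorem eq_of_forall_fderiv_single_eq_zero {ι : Type*} [Fintype ι] [DecidableEq ι]
    {g : (ι → ℝ) → ℝ} (hg : Differentiable ℝ g)
    (h : ∀ y j, fderiv ℝ g y (Pi.single j 1) = 0) (y y' : ι → ℝ) : g y = g y' := by
  refine is_const_of_fderiv_eq_zero hg (fun z => ?_) y y'
  refine ContinuousLinearMap.coe_injective ((Pi.basisFun ℝ ι).ext fun j => ?_)
  simpa using h z j

/-- A linear combination `Σ_k c^k v_k` of the normalized
basis fields `v_k = ∂_{x^{k,+}} + Σ_i a_k^i ∂_{x^{i,+}} + Σ_j b_k^j ∂_{ξ^j}`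
is projectable (its `x⁺`-components depend only on `x⁺`) if and only if all
coefficients `c^k` are independent of `ξ` and satisfy the `(n−m)·m` algebraic
equations `Σ_k c^k ∂_{ξ^j} a_k^i = 0` for `i = m+1,…,n` and `j = 1,…,m`. -/
theorem projectable_linear_combination_criterion {m r : ℕ}
    (a : Fin m → Fin r → (((Fin m → ℝ) × (Fin r → ℝ)) × (Fin m → ℝ)) → ℝ)
    (b : Fin m → Fin m → (((Fin m → ℝ) × (Fin r → ℝ)) × (Fin m → ℝ)) → ℝ)
    (c : Fin m → (((Fin m → ℝ) × (Fin r → ℝ)) × (Fin m → ℝ)) → ℝ)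
    (ha : ∀ k i, ContDiff ℝ (⊤ : ℕ∞) (a k i))
    (hb : ∀ k j, ContDiff ℝ (⊤ : ℕ∞) (b k j))
    (hc : ∀ k, ContDiff ℝ (⊤ : ℕ∞) (c k))
    -- the normalized basis vector fields `v_k`
    (v : Fin m → (((Fin m → ℝ) × (Fin r → ℝ)) × (Fin m → ℝ)) →
      (((Fin m → ℝ) × (Fin r → ℝ)) × (Fin m → ℝ)))
    (hv : ∀ k p, v k p =
      ((Pi.single k (1 : ℝ), fun i => a k i p), fun j => b k j p)) :
    -- the linear combination `Σ_k c^k v_k` is projectable …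
    (∃ w : ((Fin m → ℝ) × (Fin r → ℝ)) → ((Fin m → ℝ) × (Fin r → ℝ)),
      ∀ p : ((Fin m → ℝ) × (Fin r → ℝ)) × (Fin m → ℝ),
        (∑ k, c k p • v k p).1 = w p.1)
    ↔
    -- … iff all `c^k` are independent of `ξ` …
    ((∀ k, ∀ p p' : ((Fin m → ℝ) × (Fin r → ℝ)) × (Fin m → ℝ),
        p.1 = p'.1 → c k p = c k p') ∧
     -- … and the `(n−m)·m` equations `c^k ∂_{ξ^j} a_k^i = 0` hold
     (∀ (p : ((Fin m → ℝ) × (Fin r → ℝ)) × (Fin m → ℝ)) (i : Fin r) (j : Fin m),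
        ∑ k, c k p *
          fderiv ℝ (fun ξ : Fin m → ℝ => a k i (p.1, ξ)) p.2 (Pi.single j 1)
          = 0)) := by
  have hfst (p) : (∑ k, c k p • v k p).1 = (fun k => c k p, fun i => ∑ k, c k p * a k i p) := by
    rw [Prod.fst_sum]
    refine Prod.ext ?_ ?_
    · ext l
      simp [Prod.fst_sum, hv, Pi.single_apply]
    · ext i
      simp [Prod.snd_sum, hv]
  have hdiff (k i x) : Differentiable ℝ (fun ξ : Fin m → ℝ => a k i (x, ξ)) :=
    ((ha k i).differentiable (by simp)).comp (by fun_prop)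
  simp only [hfst]
  constructor
  · rintro ⟨w, hw⟩
    have hconst (k) (p p' : ((Fin m → ℝ) × (Fin r → ℝ)) × (Fin m → ℝ)) (h : p.1 = p'.1) :
        c k p = c k p' :=
      congrFun (congrArg Prod.fst ((hw p).trans ((congrArg w h).trans (hw p').symm))) k
    refine ⟨hconst, fun p i j => ?_⟩
    rw [← fderiv_sum_const_mul (fun k => hdiff k i p.1 p.2)]
    have hsum : (fun ξ => ∑ k, c k p * a k i (p.1, ξ)) = fun _ => (w p.1).2 i := by
      ext ξ
      rw [← congrFun (congrArg Prod.snd (hw (p.1, ξ))) i]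
      exact Finset.sum_congr rfl fun k _ => by rw [hconst k p (p.1, ξ) rfl]
    simp [hsum]
  · rintro ⟨hconst, heq⟩
    refine ⟨fun x => (fun k => c k (x, 0), fun i => ∑ k, c k (x, 0) * a k i (x, 0)), ?_⟩
    rintro ⟨x, ξ⟩
    have hc0 (k η) : c k (x, η) = c k (x, 0) := hconst k _ _ rfl
    simp only [hc0, Prod.mk.injEq, true_and]
    ext i
    refine eq_of_forall_fderiv_single_eq_zero (g := fun η => ∑ k, c k (x, 0) * a k i (x, η))
      (Differentiable.fun_sum fun k _ => (hdiff k i x).const_mul _) (fun η j => ?_) ξ 0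
    rw [fderiv_sum_const_mul fun k => hdiff k i x η]
    simpa only [hc0] using heq (x, η) i j
end
end

section
/- The exact discretization of the kinematic model of a wheeled mobile robot, given by x^{1,+} = x¹ + 2u¹ψ(u²)cos(x³ + (T/2)u²), x^{2,+} = x² + 2u¹ψ(u²)sin(x³ + (T/2)u²), x^{3,+} = x³ + T u², where T > 0 is the sampling time and ψ(u²) = sin((T/2)u²)/u² for u² ≠ 0 and ψ(0) = T/2, is not flat around any equilibrium: there exists no nonzero projectable vector field contained in the input distribution span{∂_{u¹}, ∂_{u²}}, hence no 1-dimensional projectable involutive subdistribution D ⊂ span{∂_u}, and therefore no flat output exists. -/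
/-!
Discrete-time systems `x⁺ = f(x,u)` and difference flatness, following
Kolar–Schöberl–Diwold, "Differential-Geometric Decomposition of Flat Nonlinear
Discrete-Time Systems".
-/

open Filter Topology Function

noncomputable section

/-- The function `ψ` appearing in the exact discretization of the wheeled
mobile robot: `ψ(u²) = sin(Tu²/2)/u²` for `u² ≠ 0` and `ψ(0) = T/2`. -/
def psiR (T : ℝ) (s : ℝ) : ℝ := if s = 0 then T / 2 else Real.sin (T / 2 * s) / s

/-- The exact discretization of the kinematic model of a wheeled mobile robot
with sampling time `T`. -/
def robot (T : ℝ) (x : Fin 3 → ℝ) (u : Fin 2 → ℝ) : Fin 3 → ℝ :=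
  ![x 0 + 2 * u 0 * psiR T (u 1) * Real.cos (x 2 + T / 2 * u 1),
    x 1 + 2 * u 0 * psiR T (u 1) * Real.sin (x 2 + T / 2 * u 1),
    x 2 + T * u 1]

open scoped BoundedContinuousFunction

section BoundedTrajectories

variable {X U : Type*} [NormedAddCommGroup U] [NormedSpace ℝ U]

/-- Prepending a value to a bounded sequence, as a continuous linear map. -/
def consCLM (U : Type*) [NormedAddCommGroup U] [NormedSpace ℝ U] :
    U × (ℕ →ᵇ U) →L[ℝ] (ℕ →ᵇ U) :=
  LinearMap.mkContinuous
    { toFun := fun p => BoundedContinuousFunction.ofNormedAddCommGroupDiscrete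
        (fun k => Nat.casesOn k p.1 fun j => p.2 j) ‖p‖ (by
          rintro (_ | k)
          · exact norm_fst_le p
          · exact (p.2.norm_coe_le_norm k).trans (norm_snd_le p))
      map_add' := fun p q => by ext (_ | k) <;> rfl
      map_smul' := fun c p => by ext (_ | k) <;> rfl } 1 (fun p => by
        rw [one_mul]
        refine (BoundedContinuousFunction.norm_le (norm_nonneg p)).2 ?_
        rintro (_ | k)
        · exact norm_fst_le p
        · exact (p.2.norm_coe_le_norm k).trans (norm_snd_le p))

@[simp] theorem consCLM_zero (p : U × (ℕ →ᵇ U)) : consCLM U p 0 = p.1 := rfl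

@[simp] theorem consCLM_succ (p : U × (ℕ →ᵇ U)) (k : ℕ) : consCLM U p (k + 1) = p.2 k := rfl

/-- Dropping the first value of a bounded sequence, as a continuous linear map. -/
def tailCLM (U : Type*) [NormedAddCommGroup U] [NormedSpace ℝ U] : (ℕ →ᵇ U) →L[ℝ] (ℕ →ᵇ U) :=
  BoundedContinuousFunction.compContinuousCLM U ℝ ⟨Nat.succ, continuous_of_discreteTopology⟩

@[simp] theorem tailCLM_apply (u : ℕ →ᵇ U) (k : ℕ) : tailCLM U u k = u (k + 1) := rfl

/-- The forward shift restricted to bounded input sequences, which form a normed space. -/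
def boundedShift (f : X → U → X) (z : X × (ℕ →ᵇ U)) : X × (ℕ →ᵇ U) :=
  (f z.1 (z.2 0), tailCLM U z.2)

/-- Backward extension of a bounded trajectory by an input, where `g · s` inverts `f · s`. -/
def extendBack (g : X → U → X) (p : U × (X × (ℕ →ᵇ U))) : X × (ℕ →ᵇ U) :=
  (g p.2.1 p.1, consCLM U (p.1, p.2.2))

/-- Forgetting that the input sequence is bounded. -/
def forgetBounded (z : X × (ℕ →ᵇ U)) : X × (ℕ → U) := (z.1, z.2)

theorem shift_forgetBounded (f : X → U → X) (z : X × (ℕ →ᵇ U)) :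
    shift f (forgetBounded z) = forgetBounded (boundedShift f z) := rfl

theorem iterate_shift_forgetBounded (f : X → U → X) (n : ℕ) (z : X × (ℕ →ᵇ U)) :
    (shift f)^[n] (forgetBounded z) = forgetBounded ((boundedShift f)^[n] z) :=
  ((Semiconj.iterate_right (show Semiconj forgetBounded (boundedShift f) (shift f) from
    fun z => (shift_forgetBounded f z).symm) n) z).symm

theorem boundedShift_extendBack {f g : X → U → X} (hfg : ∀ x s, f (g x s) s = x)
    (p : U × (X × (ℕ →ᵇ U))) : boundedShift f (extendBack g p) = p.2 :=
  Prod.ext (hfg _ _) (by ext k; rfl)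

theorem extendBack_boundedShift {f g : X → U → X} (hgf : ∀ x s, g (f x s) s = x)
    (z : X × (ℕ →ᵇ U)) : extendBack g (z.2 0, boundedShift f z) = z :=
  Prod.ext (hgf _ _) (by ext (_ | k) <;> rfl)

variable [NormedAddCommGroup X]

theorem continuous_forgetBounded : Continuous (forgetBounded : X × (ℕ →ᵇ U) → X × (ℕ → U)) :=
  continuous_fst.prodMk (continuous_pi fun k =>
    (BoundedContinuousFunction.evalCLM ℝ k).continuous.comp continuous_snd)

variable [NormedSpace ℝ X]

/-- The current state and input, as a continuous linear map on bounded trajectories. -/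
def currentCLM (X U : Type*) [NormedAddCommGroup X] [NormedSpace ℝ X]
    [NormedAddCommGroup U] [NormedSpace ℝ U] : X × (ℕ →ᵇ U) →L[ℝ] X × U :=
  (ContinuousLinearMap.fst ℝ X (ℕ →ᵇ U)).prod
    ((BoundedContinuousFunction.evalCLM ℝ 0).comp (ContinuousLinearMap.snd ℝ X (ℕ →ᵇ U)))

@[simp] theorem currentCLM_apply (z : X × (ℕ →ᵇ U)) : currentCLM X U z = (z.1, z.2 0) := rfl

theorem differentiable_boundedShift {f : X → U → X} (hf : Differentiable ℝ (uncurry f)) :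
    Differentiable ℝ (boundedShift f) :=
  (hf.comp (currentCLM X U).differentiable).prodMk
    ((tailCLM U).differentiable.comp differentiable_snd)

theorem fst_fderiv_boundedShift {f : X → U → X} (hf : Differentiable ℝ (uncurry f))
    (z ξ : X × (ℕ →ᵇ U)) :
    (fderiv ℝ (boundedShift f) z ξ).1 = fderiv ℝ (uncurry f) (z.1, z.2 0) (ξ.1, ξ.2 0) := by
  have h : HasFDerivAt (boundedShift f) _ z :=
    ((hf _).hasFDerivAt.comp z (currentCLM X U).hasFDerivAt).prodMk
      ((tailCLM U).hasFDerivAt.comp z hasFDerivAt_snd)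
  rw [h.fderiv]
  rfl

theorem differentiable_extendBack {g : X → U → X} (hg : Differentiable ℝ (uncurry g)) :
    Differentiable ℝ (extendBack g) :=
  (hg.comp (f := fun p : U × (X × (ℕ →ᵇ U)) => (p.2.1, p.1)) (by fun_prop)).prodMk
    ((consCLM U).differentiable.comp (f := fun p : U × (X × (ℕ →ᵇ U)) => (p.1, p.2.2))
      (by fun_prop))

/-- An infinitesimal backward extension: every tangent vector at the shifted point lifts, with
any prescribed change of the current input. -/
theorem fderiv_boundedShift_fderiv_extendBack {f g : X → U → X}
    (hf : Differentiable ℝ (uncurry f)) (hg : Differentiable ℝ (uncurry g))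
    (hfg : ∀ x s, f (g x s) s = x) (hgf : ∀ x s, g (f x s) s = x)
    (z : X × (ℕ →ᵇ U)) (η : U × (X × (ℕ →ᵇ U))) :
    fderiv ℝ (boundedShift f) z
      (fderiv ℝ (extendBack g) (z.2 0, boundedShift f z) η) = η.2 := by
  have h := (((differentiable_boundedShift hf) _).hasFDerivAt.comp _
    ((differentiable_extendBack hg) (z.2 0, boundedShift f z)).hasFDerivAt)
  rw [extendBack_boundedShift hgf] at h
  have h' : boundedShift f ∘ extendBack g = Prod.snd := funext (boundedShift_extendBack hfg)
  rw [h'] at h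
  exact congrArg (fun L => L η) (h.unique hasFDerivAt_snd)

theorem fderiv_extendBack_snd_zero {g : X → U → X} (hg : Differentiable ℝ (uncurry g))
    (p η : U × (X × (ℕ →ᵇ U))) : (fderiv ℝ (extendBack g) p η).2 0 = η.1 := by
  have h := ((BoundedContinuousFunction.evalCLM ℝ 0).comp
    (ContinuousLinearMap.snd ℝ X (ℕ →ᵇ U))).hasFDerivAt.comp p
    ((differentiable_extendBack hg) p).hasFDerivAt
  exact congrArg (fun L => L η) (h.unique hasFDerivAt_fst)

end BoundedTrajectories

section FlatOutput

variable {X U : Type*} [NormedAddCommGroup X] [NormedSpace ℝ X]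
  [NormedAddCommGroup U] [NormedSpace ℝ U] {f g : X → U → X} {φ : X × (ℕ →ᵇ U) → U}
  {N : ℕ} {E : (Fin N → U) → X × U} {z₀ : X × (ℕ →ᵇ U)}

/-- The `α`-th forward shift of an output. -/
def shiftedOutput (f : X → U → X) (φ : X × (ℕ →ᵇ U) → U) (α : ℕ) (z : X × (ℕ →ᵇ U)) : U :=
  φ ((boundedShift f)^[α] z)

theorem differentiable_shiftedOutput (hf : Differentiable ℝ (uncurry f))
    (hφ : Differentiable ℝ φ) (α : ℕ) : Differentiable ℝ (shiftedOutput f φ α) :=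
  hφ.comp ((differentiable_boundedShift hf).iterate α)

theorem fderiv_shiftedOutput_succ (hf : Differentiable ℝ (uncurry f))
    (hφ : Differentiable ℝ φ) (α : ℕ) (z ξ : X × (ℕ →ᵇ U)) :
    fderiv ℝ (shiftedOutput f φ (α + 1)) z ξ =
      fderiv ℝ (shiftedOutput f φ α) (boundedShift f z) (fderiv ℝ (boundedShift f) z ξ) :=
  congrArg (fun L => L ξ) (((differentiable_shiftedOutput hf hφ α _).hasFDerivAt.comp z
    (differentiable_boundedShift hf z).hasFDerivAt).fderiv)

/-- Infinitesimal form of the reconstruction of `(x, u)` from the shifted outputs. -/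
theorem fderiv_reconstruction (hf : Differentiable ℝ (uncurry f)) (hφ : Differentiable ℝ φ)
    (hE : Differentiable ℝ E) {z : X × (ℕ →ᵇ U)}
    (h : ∀ᶠ y in 𝓝 z, E (fun α => shiftedOutput f φ α y) = currentCLM X U y)
    (ξ : X × (ℕ →ᵇ U)) :
    fderiv ℝ E (fun α => shiftedOutput f φ α z)
      (fun α => fderiv ℝ (shiftedOutput f φ α) z ξ) = (ξ.1, ξ.2 0) := by
  have hY : HasFDerivAt (fun y => fun α : Fin N => shiftedOutput f φ α y) _ z :=
    hasFDerivAt_pi.2 fun α => (differentiable_shiftedOutput hf hφ α z).hasFDerivAt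
  have h₁ := (hE _).hasFDerivAt.comp z hY
  have h₂ := (currentCLM X U).hasFDerivAt.congr_of_eventuallyEq h
  exact congrArg (fun L => L ξ) (h₁.unique h₂)

/-- Near the equilibrium the differentials of the shifted outputs are independent: each of them
can be prescribed while all the others vanish. -/
theorem exists_dual_tangent [FiniteDimensional ℝ U]
    (hf : Differentiable ℝ (uncurry f)) (hg : Differentiable ℝ (uncurry g))
    (hfg : ∀ x s, f (g x s) s = x) (hgf : ∀ x s, g (f x s) s = x)
    (hφ : Differentiable ℝ φ) (hE : Differentiable ℝ E) (hz₀ : boundedShift f z₀ = z₀)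
    (h : ∀ᶠ y in 𝓝 z₀, E (fun α => shiftedOutput f φ α y) = currentCLM X U y) (k : ℕ) :
    ∀ᶠ z in 𝓝 z₀, ∀ c : U, ∃ ξ, ∀ α,
      fderiv ℝ (shiftedOutput f φ α) z ξ = if α = k then c else 0 := by
  -- along the fibre of the shift, the unshifted output can be adjusted arbitrarily
  have adjust : ∀ᶠ z in 𝓝 z₀, ∀ c : U, ∃ s : U,
      fderiv ℝ (shiftedOutput f φ 0) z
        (fderiv ℝ (extendBack g) (z.2 0, boundedShift f z) (s, 0)) = c := by
    filter_upwards [h.eventually_nhds] with z hz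
    let L : U →ₗ[ℝ] U := ((fderiv ℝ (shiftedOutput f φ 0) z).comp
      ((fderiv ℝ (extendBack g) (z.2 0, boundedShift f z)).comp
        (ContinuousLinearMap.inl ℝ U (X × (ℕ →ᵇ U))))).toLinearMap
    have hL : Injective L := by
      refine (injective_iff_map_eq_zero L).2 fun s hs => ?_
      have hrec := fderiv_reconstruction hf hφ hE hz
        (fderiv ℝ (extendBack g) (z.2 0, boundedShift f z) (s, 0))
      have hzero : (fun α : Fin N => fderiv ℝ (shiftedOutput f φ α) z
          (fderiv ℝ (extendBack g) (z.2 0, boundedShift f z) (s, 0))) = 0 := by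
        funext ⟨α, hα⟩
        cases α with
        | zero => exact hs
        | succ α =>
          simp only [fderiv_shiftedOutput_succ hf hφ,
            fderiv_boundedShift_fderiv_extendBack hf hg hfg hgf, map_zero, Pi.zero_apply]
      rw [hzero, map_zero, fderiv_extendBack_snd_zero hg] at hrec
      exact (congrArg Prod.snd hrec).symm
    exact fun c => LinearMap.surjective_of_injective hL c
  have hlift : Tendsto (boundedShift f) (𝓝 z₀) (𝓝 z₀) := by
    simpa only [hz₀] using (differentiable_boundedShift hf).continuous.tendsto z₀
  induction k with
  | zero =>
    filter_upwards [adjust] with z hz c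
    obtain ⟨s, hs⟩ := hz c
    refine ⟨fderiv ℝ (extendBack g) (z.2 0, boundedShift f z) (s, 0), fun α => ?_⟩
    cases α with
    | zero => simpa using hs
    | succ α =>
      simp [fderiv_shiftedOutput_succ hf hφ,
        fderiv_boundedShift_fderiv_extendBack hf hg hfg hgf]
  | succ k ih =>
    filter_upwards [adjust, hlift.eventually ih] with z hz hk c
    obtain ⟨ξ, hξ⟩ := hk c
    obtain ⟨s, hs⟩ := hz (-fderiv ℝ (shiftedOutput f φ 0) z
      (fderiv ℝ (extendBack g) (z.2 0, boundedShift f z) (0, ξ)))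
    refine ⟨fderiv ℝ (extendBack g) (z.2 0, boundedShift f z) (s, 0) +
      fderiv ℝ (extendBack g) (z.2 0, boundedShift f z) (0, ξ), fun α => ?_⟩
    cases α with
    | zero => rw [map_add, hs]; simp
    | succ α =>
      rw [map_add]
      simp only [fderiv_shiftedOutput_succ hf hφ,
        fderiv_boundedShift_fderiv_extendBack hf hg hfg hgf, hξ, map_zero, zero_add,
        Nat.add_right_cancel_iff]

/-- If only the zero vector lies in the images of all the input derivatives along each fibre of
`f`, then the reconstruction of the state does not depend on any shifted output to first order. -/
theorem fst_fderiv_reconstruction_single [FiniteDimensional ℝ U]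
    (hf : Differentiable ℝ (uncurry f)) (hg : Differentiable ℝ (uncurry g))
    (hfg : ∀ x s, f (g x s) s = x) (hgf : ∀ x s, g (f x s) s = x)
    (hφ : Differentiable ℝ φ) (hE : Differentiable ℝ E) (hz₀ : boundedShift f z₀ = z₀)
    (h : ∀ᶠ y in 𝓝 z₀, E (fun α => shiftedOutput f φ α y) = currentCLM X U y)
    (hnd : ∀ x w, (∀ᶠ s in 𝓝 (z₀.2 0), ∃ v, fderiv ℝ (uncurry f) (g x s, s) (0, v) = w) → w = 0)
    (j k : ℕ) (hjk : N ≤ k + j) :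
    ∀ᶠ z in 𝓝 z₀, ∀ c : U, (fderiv ℝ E (fun α => shiftedOutput f φ α z)
      (fun α : Fin N => if (α : ℕ) = k then c else 0)).1 = 0 := by
  induction j generalizing k with
  | zero =>
    refine Eventually.of_forall fun z c => ?_
    have : (fun α : Fin N => if (α : ℕ) = k then c else 0) = 0 := by
      funext α
      exact if_neg (by have := α.2; omega)
    rw [this, map_zero]
    rfl
  | succ j ih =>
    have hshift : Tendsto (boundedShift f) (𝓝 z₀) (𝓝 z₀) := by
      simpa only [hz₀] using (differentiable_boundedShift hf).continuous.tendsto z₀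
    have key : ∀ᶠ z in 𝓝 z₀, ∀ c : U, ∃ v, fderiv ℝ (uncurry f) (z.1, z.2 0) (0, v) =
        (fderiv ℝ E (fun α => shiftedOutput f φ α (boundedShift f z))
          (fun α : Fin N => if (α : ℕ) = k then c else 0)).1 := by
      filter_upwards [ih (k + 1) (by omega),
        exists_dual_tangent hf hg hfg hgf hφ hE hz₀ h (k + 1),
        h.eventually_nhds, hshift.eventually h.eventually_nhds] with z hk hdual hz hsz c
      obtain ⟨ξ, hξ⟩ := hdual c
      have hfst : ξ.1 = 0 := by
        have := fderiv_reconstruction hf hφ hE hz ξ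
        simp only [hξ] at this
        rw [← hk c, this]
      have hrec := fderiv_reconstruction hf hφ hE hsz (fderiv ℝ (boundedShift f) z ξ)
      simp only [← fderiv_shiftedOutput_succ hf hφ, hξ, Nat.add_right_cancel_iff] at hrec
      refine ⟨ξ.2 0, ?_⟩
      rw [hrec, fst_fderiv_boundedShift hf, hfst]
    have hback : Tendsto (extendBack g) (𝓝 z₀ ×ˢ 𝓝 (z₀.2 0) |>.map Prod.swap) (𝓝 z₀) := by
      rw [← prod_comm, ← nhds_prod_eq]
      have := (differentiable_extendBack hg).continuous.tendsto (z₀.2 0, z₀)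
      have hfix := extendBack_boundedShift hgf z₀
      rw [hz₀] at hfix
      rwa [hfix] at this
    filter_upwards [(tendsto_map'_iff.1 hback |>.eventually key).curry] with z hz c
    refine hnd z.1 _ (hz.mono fun s hs => ?_)
    obtain ⟨v, hv⟩ := hs c
    refine ⟨v, ?_⟩
    simp only [comp_apply, Prod.swap_prod_mk, boundedShift_extendBack hfg] at hv
    exact hv

/-- A system whose state map is invertible for each input is not flat around an equilibrium if
only the zero vector lies in the images of all the input derivatives along each fibre of `f`. -/
theorem not_isFlat_of_iInter_range_eq_zero [Nontrivial X] [FiniteDimensional ℝ U]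
    (hf : Differentiable ℝ (uncurry f)) (hg : Differentiable ℝ (uncurry g))
    (hfg : ∀ x s, f (g x s) s = x) (hgf : ∀ x s, g (f x s) s = x)
    {x₀ : X} {u₀ : U} (heq : f x₀ u₀ = x₀)
    (hnd : ∀ x w, (∀ᶠ s in 𝓝 u₀, ∃ v, fderiv ℝ (uncurry f) (g x s, s) (0, v) = w) → w = 0) :
    ¬ IsFlat f x₀ u₀ := by
  rintro ⟨φ, ⟨q, ψ, hψ, hφψ⟩, N, E, hE, h⟩
  let z₀ : X × (ℕ →ᵇ U) := (x₀, BoundedContinuousFunction.const ℕ u₀)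
  have hz₀ : boundedShift f z₀ = z₀ := Prod.ext heq (by ext k; rfl)
  have hφ : Differentiable ℝ (fun z : X × (ℕ →ᵇ U) => φ (forgetBounded z)) := by
    simp only [hφψ]
    refine (hψ.differentiable (by simp)).comp
      (differentiable_fst.prodMk (differentiable_pi.2 fun k => ?_))
    exact ((BoundedContinuousFunction.evalCLM ℝ (k : ℕ)).comp
      (ContinuousLinearMap.snd ℝ X (ℕ →ᵇ U))).differentiable
  have hE' : Differentiable ℝ E := hE.differentiable (by simp)
  have hrec : ∀ᶠ z in 𝓝 z₀,
      E (fun α => shiftedOutput f (fun z => φ (forgetBounded z)) α z) = currentCLM X U z := by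
    have := (continuous_forgetBounded.tendsto z₀).eventually h
    simp only [iterate_shift_forgetBounded] at this
    exact this
  obtain ⟨x, hx⟩ := exists_ne (0 : X)
  have hd := fderiv_reconstruction hf hφ hE' hrec (x, 0)
  have hsum (y : Fin N → U) :
      y = ∑ k : Fin N, fun α : Fin N => if (α : ℕ) = k then y k else 0 := by
    funext α
    simp [Finset.sum_apply, Fin.val_inj]
  rw [hsum (fun α => fderiv ℝ _ z₀ (x, 0)), map_sum] at hd
  refine hx ?_
  have hfst := congrArg Prod.fst hd
  rw [Prod.fst_sum] at hfst
  refine hfst.symm.trans (Finset.sum_eq_zero fun k _ => ?_)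
  exact (fst_fderiv_reconstruction_single hf hg hfg hgf hφ hE' hz₀ hrec hnd N k
    (by omega)).self_of_nhds _

end FlatOutput

section Robot

theorem psiR_eq_sinc (T : ℝ) : psiR T = fun s => T / 2 * Real.sinc (T / 2 * s) := by
  funext s
  rcases eq_or_ne s 0 with rfl | hs
  · simp [psiR]
  rcases eq_or_ne T 0 with rfl | hT
  · simp [psiR]
  · rw [psiR, if_neg hs, Real.sinc_of_ne_zero (by positivity)]
    field_simp

theorem differentiable_sinc : Differentiable ℝ Real.sinc := by
  intro x
  rw [Real.sinc_eq_dslope]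
  rcases eq_or_ne x 0 with rfl | hx
  · obtain ⟨p, hp⟩ := Real.analyticAt_sin (x := 0)
    exact hp.has_fpower_series_dslope_fslope.analyticAt.differentiableAt
  · exact (differentiableAt_dslope_of_ne hx).2 Real.differentiableAt_sin

theorem differentiable_psiR (T : ℝ) : Differentiable ℝ (psiR T) := by
  rw [psiR_eq_sinc]
  exact (differentiable_sinc.comp (differentiable_id.const_mul (T / 2))).const_mul (T / 2)

@[simp] theorem psiR_zero (T : ℝ) : psiR T 0 = T / 2 := if_pos rfl

/-- The inverse of the state map of the robot for a fixed input. -/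
def robotInv (T : ℝ) (x : Fin 3 → ℝ) (u : Fin 2 → ℝ) : Fin 3 → ℝ :=
  ![x 0 - 2 * u 0 * psiR T (u 1) * Real.cos (x 2 - T / 2 * u 1),
    x 1 - 2 * u 0 * psiR T (u 1) * Real.sin (x 2 - T / 2 * u 1),
    x 2 - T * u 1]

theorem robot_robotInv (T : ℝ) (x : Fin 3 → ℝ) (u : Fin 2 → ℝ) :
    robot T (robotInv T x u) u = x := by
  have h : x 2 - T * u 1 + T / 2 * u 1 = x 2 - T / 2 * u 1 := by ring
  funext i
  fin_cases i <;> simp [robot, robotInv, h]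

theorem robotInv_robot (T : ℝ) (x : Fin 3 → ℝ) (u : Fin 2 → ℝ) :
    robotInv T (robot T x u) u = x := by
  have h : x 2 + T * u 1 - T / 2 * u 1 = x 2 + T / 2 * u 1 := by ring
  funext i
  fin_cases i <;> simp [robot, robotInv, h]

theorem differentiable_robot (T : ℝ) : Differentiable ℝ (uncurry (robot T)) := by
  have hψ := differentiable_psiR T
  refine differentiable_pi.2 fun i => ?_
  fin_cases i <;> simp only [uncurry, robot] <;> dsimp <;> fun_prop

theorem differentiable_robotInv (T : ℝ) : Differentiable ℝ (uncurry (robotInv T)) := by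
  have hψ := differentiable_psiR T
  refine differentiable_pi.2 fun i => ?_
  fin_cases i <;> simp only [uncurry, robotInv] <;> dsimp <;> fun_prop

/-- The derivative of the robot in the direction of the inputs, in the frame given by the
direction of travel. -/
theorem fderiv_robot_input (T : ℝ) (x : Fin 3 → ℝ) (u v : Fin 2 → ℝ) :
    fderiv ℝ (uncurry (robot T)) (x, u) (0, v) =
      ![(2 * v 0 * psiR T (u 1) + 2 * u 0 * (deriv (psiR T) (u 1) * v 1)) *
            Real.cos (x 2 + T / 2 * u 1) -
          T * u 0 * psiR T (u 1) * v 1 * Real.sin (x 2 + T / 2 * u 1),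
        (2 * v 0 * psiR T (u 1) + 2 * u 0 * (deriv (psiR T) (u 1) * v 1)) *
            Real.sin (x 2 + T / 2 * u 1) +
          T * u 0 * psiR T (u 1) * v 1 * Real.cos (x 2 + T / 2 * u 1),
        T * v 1] := by
  have hline : HasDerivAt (fun t : ℝ => (x, u + t • v)) ((0 : Fin 3 → ℝ), v) 0 := by
    simpa using (hasDerivAt_const (0 : ℝ) x).prodMk
      (((hasDerivAt_id (0 : ℝ)).smul_const v).const_add u)
  have hF : HasFDerivAt (uncurry (robot T)) (fderiv ℝ (uncurry (robot T)) (x, u))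
      (x, u + (0 : ℝ) • v) := by
    simpa using (differentiable_robot T (x, u)).hasFDerivAt
  have hcurve := hF.comp_hasDerivAt (0 : ℝ) hline
  have hu (i : Fin 2) : HasDerivAt (fun t : ℝ => u i + t * v i) (v i) 0 := by
    simpa using ((hasDerivAt_id (0 : ℝ)).mul_const (v i)).const_add (u i)
  have hψ : HasDerivAt (fun t : ℝ => psiR T (u 1 + t * v 1)) (deriv (psiR T) (u 1) * v 1) 0 := by
    have h : HasDerivAt (psiR T) (deriv (psiR T) (u 1)) (u 1 + 0 * v 1) := by
      simpa using (differentiable_psiR T (u 1)).hasDerivAt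
    exact h.comp (0 : ℝ) (hu 1)
  have hα : HasDerivAt (fun t : ℝ => x 2 + T / 2 * (u 1 + t * v 1)) (T / 2 * v 1) 0 :=
    ((hu 1).const_mul (T / 2)).const_add (x 2)
  have hr := ((hu 0).const_mul 2).mul hψ
  refine hcurve.unique (hasDerivAt_pi.2 fun i => ?_)
  fin_cases i
  · refine ((hr.mul hα.cos).const_add (x 0)).congr_deriv ?_
    simp
    ring
  · refine ((hr.mul hα.sin).const_add (x 1)).congr_deriv ?_
    simp
    ring
  · exact ((hu 1).const_mul T).const_add (x 2)

/-- Along a fibre of the robot map only the zero vector lies in all the images of the input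
derivatives. -/
theorem robot_iInter_range_eq_zero {T : ℝ} (hT : 0 < T) (x w : Fin 3 → ℝ)
    (h : ∀ᶠ s in 𝓝 (0 : Fin 2 → ℝ),
      ∃ v, fderiv ℝ (uncurry (robot T)) (robotInv T x s, s) (0, v) = w) : w = 0 := by
  have hnormal : ∀ᶠ s in 𝓝 (0 : Fin 2 → ℝ),
      w 1 * Real.cos (x 2 - T / 2 * s 1) - w 0 * Real.sin (x 2 - T / 2 * s 1) =
        s 0 * psiR T (s 1) * w 2 := by
    filter_upwards [h] with s ⟨v, hv⟩
    have hα : robotInv T x s 2 + T / 2 * s 1 = x 2 - T / 2 * s 1 := by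
      simp [robotInv]
      ring
    rw [fderiv_robot_input, hα] at hv
    subst hv
    simp
    linear_combination (T * s 0 * psiR T (s 1) * v 1) *
      Real.cos_sq_add_sin_sq (x 2 - T / 2 * s 1)
  obtain ⟨ε, hε, hball⟩ := Metric.eventually_nhds_iff.1 hnormal
  set δ : ℝ := min (ε / 2) (1 / T)
  have hδ0 : 0 < δ := lt_min (by positivity) (by positivity)
  have hδε : δ < ε := (min_le_left _ _).trans_lt (by linarith)
  have hδT : T / 2 * δ ≤ 1 / 2 := by
    have := mul_le_mul_of_nonneg_left (min_le_right (ε / 2) (1 / T)) hT.le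
    rw [mul_one_div_cancel hT.ne'] at this
    linarith
  have hdist (s : Fin 2 → ℝ) (h0 : ‖s 0‖ ≤ δ) (h1 : ‖s 1‖ ≤ δ) : dist s 0 < ε := by
    rw [dist_zero_right]
    refine lt_of_le_of_lt ((pi_norm_le_iff_of_nonneg hδ0.le).2 fun i => ?_) hδε
    fin_cases i
    exacts [h0, h1]
  have hδn : ‖δ‖ ≤ δ := (Real.norm_of_nonneg hδ0.le).le
  have h00 := hball (hdist ![0, 0] (by simpa using hδ0.le) (by simpa using hδ0.le))
  have h10 := hball (hdist ![δ, 0] (by simpa using hδn) (by simpa using hδ0.le))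
  have h01 := hball (hdist ![0, δ] (by simpa using hδ0.le) (by simpa using hδn))
  simp only [Matrix.cons_val_zero, Matrix.cons_val_one, psiR_zero, mul_zero, sub_zero, zero_mul,
    Real.cos_sub, Real.sin_sub] at h00 h10 h01
  have hw2 : w 2 = 0 := by
    rw [h00] at h10
    have : δ * (T / 2) ≠ 0 := by positivity
    simpa [this] using h10.symm
  have hsin : Real.sin (T / 2 * δ) ≠ 0 :=
    (Real.sin_pos_of_pos_of_lt_pi (by positivity) (by linarith [Real.pi_gt_three])).ne'
  have htan : w 0 * Real.cos (x 2) + w 1 * Real.sin (x 2) = 0 := by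
    refine (mul_eq_zero.1 ?_).resolve_left hsin
    linear_combination h01 - Real.cos (T / 2 * δ) * h00
  have hcs := Real.cos_sq_add_sin_sq (x 2)
  funext i
  fin_cases i
  · show w 0 = 0
    linear_combination Real.cos (x 2) * htan - Real.sin (x 2) * h00 - w 0 * hcs
  · show w 1 = 0
    linear_combination Real.sin (x 2) * htan + Real.cos (x 2) * h00 - w 1 * hcs
  · exact hw2

theorem robot_equilibrium_input {T : ℝ} (hT : 0 < T) {x : Fin 3 → ℝ} {u : Fin 2 → ℝ}
    (h : x = robot T x u) : u = 0 := by
  have hu1 : u 1 = 0 := by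
    have := congrFun h 2
    simpa [robot, hT.ne'] using this
  have h0 : u 0 * T * Real.cos (x 2) = 0 := by
    have := congrFun h 0
    simp only [robot, hu1, psiR_zero, mul_zero, add_zero, Matrix.cons_val_zero] at this
    linear_combination -this
  have h1 : u 0 * T * Real.sin (x 2) = 0 := by
    have := congrFun h 1
    simp only [robot, hu1, psiR_zero, mul_zero, add_zero, Matrix.cons_val_one,
      Matrix.cons_val_zero] at this
    linear_combination -this
  have hu0 : u 0 = 0 := by
    refine (mul_eq_zero.1 ?_).resolve_right hT.ne'
    linear_combination Real.cos (x 2) * h0 + Real.sin (x 2) * h1 -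
      u 0 * T * Real.cos_sq_add_sin_sq (x 2)
  funext i
  fin_cases i
  exacts [hu0, hu1]

theorem fderiv_robot_input_zero_injective {T : ℝ} (hT : 0 < T) (x : Fin 3 → ℝ) {v : Fin 2 → ℝ}
    (h : fderiv ℝ (uncurry (robot T)) (x, 0) (0, v) = 0) : v = 0 := by
  rw [fderiv_robot_input] at h
  have h0 := congrFun h 0
  have h1 := congrFun h 1
  have h2 := congrFun h 2
  simp only [Pi.zero_apply, psiR_zero, mul_zero, add_zero, zero_mul, sub_zero,
    Matrix.cons_val_zero, Matrix.cons_val_one, Matrix.cons_val] at h0 h1 h2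
  funext i
  fin_cases i
  · refine (mul_eq_zero.1 ?_).resolve_right hT.ne'
    show v 0 * T = 0
    linear_combination Real.cos (x 2) * h0 + Real.sin (x 2) * h1 -
      v 0 * T * Real.cos_sq_add_sin_sq (x 2)
  · exact (mul_eq_zero.1 h2).resolve_left hT.ne'

end Robot

/-- The exact discretization of the wheeled mobile robot is
not flat around any equilibrium: near an equilibrium there exists no
projectable vector field contained in the input distribution
`span{∂_{u¹}, ∂_{u²}}` which is nonzero at the equilibrium (hence no
`1`-dimensional projectable involutive subdistribution `D ⊂ span{∂_u}`), and
no flat output exists. -/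
theorem robot_not_flat (T : ℝ) (hT : 0 < T)
    (x₀ : Fin 3 → ℝ) (u₀ : Fin 2 → ℝ) (heq : x₀ = robot T x₀ u₀) :
    -- no nonzero projectable vector field in the input distribution
    (¬ ∃ (S : Set ((Fin 3 → ℝ) × (Fin 2 → ℝ)))
        (v : (Fin 3 → ℝ) × (Fin 2 → ℝ) → (Fin 2 → ℝ))
        (w : (Fin 3 → ℝ) → (Fin 3 → ℝ)),
        IsOpen S ∧ (x₀, u₀) ∈ S ∧
        ContDiffOn ℝ (⊤ : ℕ∞) v S ∧
        v (x₀, u₀) ≠ 0 ∧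
        -- `f`-relatedness of `v = v^j ∂_{u^j}` and `w`
        ∀ p ∈ S,
          fderiv ℝ (fun z : (Fin 3 → ℝ) × (Fin 2 → ℝ) => robot T z.1 z.2) p
            ((0 : Fin 3 → ℝ), v p) = w (robot T p.1 p.2)) ∧
    -- and hence the system is not flat around the equilibrium
    ¬ IsFlat (robot T) x₀ u₀ := by
  obtain rfl : u₀ = 0 := robot_equilibrium_input hT heq
  refine ⟨?_, not_isFlat_of_iInter_range_eq_zero (differentiable_robot T)
    (differentiable_robotInv T) (robot_robotInv T) (robotInv_robot T) heq.symm
    (robot_iInter_range_eq_zero hT)⟩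
  rintro ⟨S, v, w, hS, hmem, -, hv, hw⟩
  have hinv : robotInv T x₀ 0 = x₀ := by
    conv_lhs => rw [heq]
    exact robotInv_robot T x₀ 0
  have hfibre : ∀ᶠ s in 𝓝 (0 : Fin 2 → ℝ), (robotInv T x₀ s, s) ∈ S := by
    have hcont : Continuous fun s : Fin 2 → ℝ => (robotInv T x₀ s, s) :=
      ((differentiable_robotInv T).continuous.comp (Continuous.prodMk_right x₀)).prodMk
        continuous_id
    exact (hcont.tendsto 0).eventually (hS.mem_nhds (by rwa [hinv]))
  have hw₀ : w x₀ = 0 := robot_iInter_range_eq_zero hT x₀ _ <| hfibre.mono fun s hs =>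
    ⟨v (robotInv T x₀ s, s), (hw _ hs).trans (congrArg w (robot_robotInv T x₀ s))⟩
  have h₀ := hw _ hmem
  rw [← heq, hw₀] at h₀
  exact hv (fderiv_robot_input_zero_injective hT x₀ h₀)
end
end

section
/- The discrete-time system x^{1,+} = (x² + x³ + 3x⁴)/(u¹ + 2u² + 1), x^{2,+} = x¹(x³+1)(u¹ + 2u² − 3) + x⁴ − 3u², x^{3,+} = u¹ + 2u², x^{4,+} = x¹(x³+1) + u² is flat around the equilibrium (x₀, u₀) = (0,0) with flat output y = (x¹(x³+1), x² + 3x⁴); explicitly, the state and input are parametrized by the flat output and its forward-shifts as x¹ = y¹/(y¹_[1] − y² + 1), x² = 3y¹(y¹_[2] − y²_[1]) + y² − 3y²_[1], x³ = y¹_[1] − y², x⁴ = y¹(y²_[1] − y¹_[2]) + y²_[1], u¹ = 2y¹ + 2y¹_[1](y¹_[3] − y²_[2]) + y¹_[2] − y²_[1] − 2y²_[2], u² = −y¹ + y¹_[1](y²_[2] − y¹_[3]) + y²_[2]. -/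
/-!
Discrete-time systems `x⁺ = f(x,u)` and difference flatness, following
Kolar–Schöberl–Diwold, "Differential-Geometric Decomposition of Flat Nonlinear
Discrete-Time Systems".
-/

open Filter Topology Function

noncomputable section

/-- The academic example system of Kolar–Schöberl–Diwold (Section 5.1). -/
def exSys (x : Fin 4 → ℝ) (u : Fin 2 → ℝ) : Fin 4 → ℝ :=
  ![(x 1 + x 2 + 3 * x 3) / (u 0 + 2 * u 1 + 1),
    x 0 * (x 2 + 1) * (u 0 + 2 * u 1 - 3) + x 3 - 3 * u 1,
    u 0 + 2 * u 1,
    x 0 * (x 2 + 1) + u 1]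

/-- The flat output `y = (x¹(x³+1), x² + 3x⁴)`, a function of the state
alone. -/
def exOut (p : (Fin 4 → ℝ) × (ℕ → Fin 2 → ℝ)) : Fin 2 → ℝ :=
  ![p.1 0 * (p.1 2 + 1), p.1 1 + 3 * p.1 3]

/-- A globally smooth function that agrees with `s ↦ (s + 1)⁻¹` near `0`. -/
theorem exists_contDiff_eq_inv_add_one :
    ∃ g : ℝ → ℝ, ContDiff ℝ (⊤ : ℕ∞) g ∧ ∀ᶠ s in 𝓝 (0 : ℝ), g s = (s + 1)⁻¹ := by
  let ψ : ContDiffBump (0 : ℝ) := ⟨1 / 4, 1 / 2, by norm_num, by norm_num⟩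
  have hpos : ∀ s : ℝ, s * ψ s + 1 ≠ 0 := by
    intro s
    by_cases hs : 1 / 2 ≤ |s|
    · rw [ψ.zero_of_le_dist (by rwa [Real.dist_eq, sub_zero])]
      norm_num
    · have h0 : 0 ≤ ψ s := ψ.nonneg
      have h1 : ψ s ≤ 1 := ψ.le_one
      have hs' := (abs_lt.mp (not_le.mp hs)).1
      nlinarith
  refine ⟨fun s => (s * ψ s + 1)⁻¹, ?_, ?_⟩
  · exact ((contDiff_id.mul ψ.contDiff).add contDiff_const).inv hpos
  · filter_upwards [ψ.eventuallyEq_one] with s hs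
    simp [hs]

/-- The parametrization of state and input of `exSys` by the flat output, valid wherever the
denominators that occur do not vanish. -/
theorem exSys_parametrization (p : (Fin 4 → ℝ) × (ℕ → Fin 2 → ℝ))
    (hx : p.1 2 + 1 ≠ 0) (h0 : p.2 0 0 + 2 * p.2 0 1 + 1 ≠ 0)
    (h1 : p.2 1 0 + 2 * p.2 1 1 + 1 ≠ 0) (h2 : p.2 2 0 + 2 * p.2 2 1 + 1 ≠ 0)
    (Y : ℕ → Fin 2 → ℝ) (hY : Y = fun α => exOut ((shift exSys)^[α] p)) :
    p.1 0 = Y 0 0 / (Y 1 0 - Y 0 1 + 1) ∧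
    p.1 1 = 3 * Y 0 0 * (Y 2 0 - Y 1 1) + Y 0 1 - 3 * Y 1 1 ∧
    p.1 2 = Y 1 0 - Y 0 1 ∧
    p.1 3 = Y 0 0 * (Y 1 1 - Y 2 0) + Y 1 1 ∧
    p.2 0 0 = 2 * Y 0 0 + 2 * Y 1 0 * (Y 3 0 - Y 2 1) + Y 2 0 - Y 1 1 - 2 * Y 2 1 ∧
    p.2 0 1 = -Y 0 0 + Y 1 0 * (Y 2 1 - Y 3 0) + Y 2 1 := by
  have shift_fst : ∀ q : (Fin 4 → ℝ) × (ℕ → Fin 2 → ℝ), q.2 0 0 + 2 * q.2 0 1 + 1 ≠ 0 →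
      exOut (shift exSys q) 0 = exOut q 1 + q.1 2 := by
    intro q hq
    simp [exOut, shift, exSys, div_mul_cancel₀ _ hq]
    ring
  have shift_snd : ∀ q : (Fin 4 → ℝ) × (ℕ → Fin 2 → ℝ),
      exOut (shift exSys q) 1 = exOut q 0 * (q.2 0 0 + 2 * q.2 0 1) + q.1 3 := by
    intro q
    simp [exOut, shift, exSys]
    ring
  have y00 : Y 0 0 = p.1 0 * (p.1 2 + 1) := by simp [hY, exOut]
  have y01 : Y 0 1 = p.1 1 + 3 * p.1 3 := by simp [hY, exOut]
  have y10 : Y 1 0 = Y 0 1 + p.1 2 := by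
    simpa [hY] using shift_fst p h0
  have y11 : Y 1 1 = Y 0 0 * (p.2 0 0 + 2 * p.2 0 1) + p.1 3 := by
    simpa [hY] using shift_snd p
  have y20 : Y 2 0 = Y 1 1 + (p.2 0 0 + 2 * p.2 0 1) := by
    simpa [hY, shift, exSys] using shift_fst (shift exSys p) h1
  have y21 : Y 2 1 = Y 1 0 * (p.2 1 0 + 2 * p.2 1 1) + (Y 0 0 + p.2 0 1) := by
    rw [y00]
    simpa [hY, shift, exSys] using shift_snd (shift exSys p)
  have y30 : Y 3 0 = Y 2 1 + (p.2 1 0 + 2 * p.2 1 1) := by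
    simpa [hY, shift, exSys] using shift_fst (shift exSys (shift exSys p)) h2
  refine ⟨?_, ?_, ?_, ?_, ?_, ?_⟩
  · rw [y10, add_sub_cancel_left, y00, mul_div_cancel_right₀ _ hx]
  · linear_combination (-3 * Y 0 0) * y20 - y01 + 3 * y11
  · linear_combination -y10
  · linear_combination Y 0 0 * y20 - y11
  · linear_combination (-2 * Y 1 0) * y30 - y20 + 2 * y21
  · linear_combination Y 1 0 * y30 - y21

/-- Near the equilibrium `(0,0)` no denominator in the parametrization vanishes. -/
theorem eventually_exSys_parametrization :
    ∀ᶠ p in 𝓝 (((0 : Fin 4 → ℝ), fun _ => (0 : Fin 2 → ℝ)) :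
        (Fin 4 → ℝ) × (ℕ → Fin 2 → ℝ)),
      ∀ Y : ℕ → Fin 2 → ℝ, Y = (fun α => exOut ((shift exSys)^[α] p)) →
        p.1 0 = Y 0 0 / (Y 1 0 - Y 0 1 + 1) ∧
        p.1 1 = 3 * Y 0 0 * (Y 2 0 - Y 1 1) + Y 0 1 - 3 * Y 1 1 ∧
        p.1 2 = Y 1 0 - Y 0 1 ∧
        p.1 3 = Y 0 0 * (Y 1 1 - Y 2 0) + Y 1 1 ∧
        p.2 0 0 = 2 * Y 0 0 + 2 * Y 1 0 * (Y 3 0 - Y 2 1) + Y 2 0 - Y 1 1 - 2 * Y 2 1 ∧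
        p.2 0 1 = -Y 0 0 + Y 1 0 * (Y 2 1 - Y 3 0) + Y 2 1 := by
  have hu : ∀ k : ℕ, ∀ᶠ p in 𝓝 (((0 : Fin 4 → ℝ), fun _ => (0 : Fin 2 → ℝ)) :
      (Fin 4 → ℝ) × (ℕ → Fin 2 → ℝ)), p.2 k 0 + 2 * p.2 k 1 + 1 ≠ 0 := fun k =>
    (by fun_prop : Continuous fun p : (Fin 4 → ℝ) × (ℕ → Fin 2 → ℝ) =>
      p.2 k 0 + 2 * p.2 k 1 + 1).continuousAt.eventually_ne (by simp)
  have hx : ∀ᶠ p in 𝓝 (((0 : Fin 4 → ℝ), fun _ => (0 : Fin 2 → ℝ)) :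
      (Fin 4 → ℝ) × (ℕ → Fin 2 → ℝ)), p.1 2 + 1 ≠ 0 :=
    (by fun_prop : Continuous fun p : (Fin 4 → ℝ) × (ℕ → Fin 2 → ℝ) =>
      p.1 2 + 1).continuousAt.eventually_ne (by simp)
  filter_upwards [hx, hu 0, hu 1, hu 2] with p hx h0 h1 h2
  exact exSys_parametrization p hx h0 h1 h2

theorem smoothFiniteDep_exOut : SmoothFiniteDep exOut := by
  refine ⟨0, fun p => ![p.1 0 * (p.1 2 + 1), p.1 1 + 3 * p.1 3], ?_, fun p => rfl⟩
  rw [contDiff_pi]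
  intro i
  fin_cases i <;> simp <;> fun_prop

theorem isFlatOutput_exOut : IsFlatOutput exSys 0 0 exOut := by
  obtain ⟨g, hg, hg_inv⟩ := exists_contDiff_eq_inv_add_one
  refine ⟨smoothFiniteDep_exOut, 4, fun Y =>
    (![Y 0 0 * g (Y 1 0 - Y 0 1),
      3 * Y 0 0 * (Y 2 0 - Y 1 1) + Y 0 1 - 3 * Y 1 1,
      Y 1 0 - Y 0 1,
      Y 0 0 * (Y 1 1 - Y 2 0) + Y 1 1],
    ![2 * Y 0 0 + 2 * Y 1 0 * (Y 3 0 - Y 2 1) + Y 2 0 - Y 1 1 - 2 * Y 2 1,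
      -Y 0 0 + Y 1 0 * (Y 2 1 - Y 3 0) + Y 2 1]), ?_, ?_⟩
  · refine ContDiff.prodMk ?_ ?_ <;> rw [contDiff_pi] <;> intro i <;> fin_cases i <;>
      simp <;> fun_prop
  · have hx : Tendsto (fun p : (Fin 4 → ℝ) × (ℕ → Fin 2 → ℝ) => p.1 2)
        (𝓝 ((0 : Fin 4 → ℝ), fun _ => (0 : Fin 2 → ℝ))) (𝓝 0) :=
      (by fun_prop : Continuous fun p : (Fin 4 → ℝ) × (ℕ → Fin 2 → ℝ) => p.1 2).tendsto _
    filter_upwards [eventually_exSys_parametrization, hx.eventually hg_inv] with p hp hgp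
    obtain ⟨hx0, hx1, hx2, hx3, hu0, hu1⟩ := hp _ rfl
    rw [hx2] at hgp
    refine Prod.ext (funext fun i => ?_) (funext fun i => ?_)
    · fin_cases i
      · exact (congrArg _ hgp).trans ((div_eq_mul_inv _ _).symm.trans hx0.symm)
      · exact hx1.symm
      · exact hx2.symm
      · exact hx3.symm
    · fin_cases i
      · exact hu0.symm
      · exact hu1.symm

/-- The academic example system is flat around the
equilibrium `(x₀,u₀) = (0,0)` with flat output `y = (x¹(x³+1), x²+3x⁴)`, and
the state and input are parametrized by the flat output and its forward shifts
by the explicit formulas given in the paper.  Below `Y α j` denotes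
`y^j_[α] = δ_{xu}^α(φ^j)`. -/
theorem exSys_flat_with_explicit_parametrization :
    -- `(0,0)` is an equilibrium
    (0 : Fin 4 → ℝ) = exSys 0 0 ∧
    -- `exOut` is a flat output around it
    IsFlatOutput exSys 0 0 exOut ∧
    -- the explicit parametrization of `x` and `u` by the flat output
    ∀ᶠ p in 𝓝 (((0 : Fin 4 → ℝ), fun _ => (0 : Fin 2 → ℝ)) :
        (Fin 4 → ℝ) × (ℕ → Fin 2 → ℝ)),
      ∀ Y : ℕ → Fin 2 → ℝ, Y = (fun α => exOut ((shift exSys)^[α] p)) →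
        p.1 0 = Y 0 0 / (Y 1 0 - Y 0 1 + 1) ∧
        p.1 1 = 3 * Y 0 0 * (Y 2 0 - Y 1 1) + Y 0 1 - 3 * Y 1 1 ∧
        p.1 2 = Y 1 0 - Y 0 1 ∧
        p.1 3 = Y 0 0 * (Y 1 1 - Y 2 0) + Y 1 1 ∧
        p.2 0 0 = 2 * Y 0 0 + 2 * Y 1 0 * (Y 3 0 - Y 2 1) + Y 2 0 - Y 1 1
          - 2 * Y 2 1 ∧
        p.2 0 1 = -Y 0 0 + Y 1 0 * (Y 2 1 - Y 3 0) + Y 2 1 := by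
  refine ⟨?_, isFlatOutput_exOut, eventually_exSys_parametrization⟩
  ext i
  fin_cases i <;> simp [exSys]
end
end
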